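/- Let p > 7 be a prime and G = PSL(2, p). Then every solvable subgroup H of G is contained in a subgroup K of G such that K is isomorphic to one of: a semidirect product of a cyclic group of order p by a cyclic group of order (p−1)/2 (i.e., there exists an action φ of Z/((p−1)/2)Z on Z/pZ with K ≅ Z/pZ ⋊_φ Z/((p−1)/2)Z); the alternating group A_4; the symmetric group S_4; the dihedral group of order p−1; or the dihedral group of order p+1. -/

import Mathlib

/-- The projective special linear group `PSL(n, R)`. -/
noncomputable abbrev PSL (n : ℕ) (R : Type*) [CommRing R] : Type _ :=
  Matrix.SpecialLinearGroup (Fin n) R ⧸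
    Subgroup.center (Matrix.SpecialLinearGroup (Fin n) R)

set_option linter.unusedSectionVars false


theorem mulEquiv_of_ker_eq {G A B : Type*} [Group G] [Group A] [Group B] (f : G →* A) (g : G →* B)
    (hf : Function.Surjective f) (hg : Function.Surjective g) (h : f.ker = g.ker) :
    Nonempty (A ≃* B) :=
  ⟨((QuotientGroup.quotientKerEquivOfSurjective f hf).symm.trans
    (QuotientGroup.quotientMulEquivOfEq h)).trans (QuotientGroup.quotientKerEquivOfSurjective g hg)⟩

theorem dihedral_recog {K : Type*} [Group K] (n : ℕ) (C : Subgroup K) [hc : IsCyclic C]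
    (hn : Nat.card C = n) (w : K) (hw : w ∉ C) (hw2 : w * w = 1)
    (hinv : ∀ c ∈ C, w * c * w = c⁻¹) (hcov : ∀ k, k ∈ C ∨ w * k ∈ C) :
    Nonempty (K ≃* DihedralGroup n) := by
  subst hn
  let e : Multiplicative (ZMod (Nat.card C)) ≃* C := zmodCyclicMulEquiv hc
  have hadd : ∀ i j, ((e (Multiplicative.ofAdd (i + j)) : C) : K) =
      e (Multiplicative.ofAdd i) * e (Multiplicative.ofAdd j) := by
    intro i j
    rw [ofAdd_add, map_mul]; rfl
  have hneg : ∀ i, ((e (Multiplicative.ofAdd (-i)) : C) : K) =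
      w * (e (Multiplicative.ofAdd i)) * w := by
    intro i
    rw [hinv _ (SetLike.coe_mem _), ofAdd_neg, map_inv]; rfl
  have hww : ∀ x, w * (w * x) = x := fun x => by rw [← mul_assoc, hw2, one_mul]
  let f : DihedralGroup (Nat.card C) →* K := MonoidHom.mk' (fun d => match d with
    | DihedralGroup.r i => e (Multiplicative.ofAdd i)
    | DihedralGroup.sr i => w * e (Multiplicative.ofAdd i)) (by
      rintro (i | i) (j | j)
      · simp [hadd]
      · simp only [DihedralGroup.r_mul_sr]
        rw [sub_eq_neg_add, hadd, hneg]
        simp only [mul_assoc, hww]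
      · simp [hadd, mul_assoc]
      · simp only [DihedralGroup.sr_mul_sr]
        rw [sub_eq_neg_add, hadd, hneg]
        simp only [mul_assoc])
  have hb : Function.Bijective f := by
    constructor
    · rw [injective_iff_map_eq_one]
      rintro (i | i) h
      · have h' : ((e (Multiplicative.ofAdd i) : C) : K) = 1 := h
        have : e (Multiplicative.ofAdd i) = 1 := Subtype.ext h'
        rw [map_eq_one_iff e e.injective] at this
        have h2 : i = 0 := this
        subst h2; rfl
      · have h' : w * ((e (Multiplicative.ofAdd i) : C) : K) = 1 := h
        exfalso; apply hw
        rw [eq_inv_of_mul_eq_one_left h']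
        exact C.inv_mem (SetLike.coe_mem _)
    · intro k
      rcases hcov k with h | h
      · refine ⟨DihedralGroup.r (Multiplicative.toAdd (e.symm ⟨k, h⟩)), ?_⟩
        change ((e (e.symm ⟨k, h⟩) : C) : K) = k
        simp
      · refine ⟨DihedralGroup.sr (Multiplicative.toAdd (e.symm ⟨w * k, h⟩)), ?_⟩
        change w * ((e (e.symm ⟨w * k, h⟩) : C) : K) = k
        simp [hww]
  exact ⟨(MulEquiv.ofBijective f hb).symm⟩

theorem semidirect_recog {K : Type*} [Group K] [Finite K] (p m : ℕ) (hp : p.Prime)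
    (hm : p.Coprime m) (hcard : Nat.card K = p * m) {R : Type*} [CommRing R] [IsDomain R]
    (f : K →* Rˣ) (hk : Nat.card f.ker = p) :
    ∃ φ : Multiplicative (ZMod m) →* MulAut (Multiplicative (ZMod p)),
          Nonempty (K ≃* SemidirectProduct (Multiplicative (ZMod p))
            (Multiplicative (ZMod m)) φ) := by
  have : Fact p.Prime := ⟨hp⟩
  set N := f.ker with hN
  have hidx : N.index = m := by
    have := N.card_mul_index
    rw [hk, hcard] at this
    exact Nat.eq_of_mul_eq_mul_left hp.pos this
  obtain ⟨C, hC⟩ := Subgroup.exists_right_complement'_of_coprime (N := N) (by rw [hk, hidx]; exact hm)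
  have hCcard : Nat.card C = m := by
    have := hC.card_mul_card
    rw [hk, hcard] at this
    exact Nat.eq_of_mul_eq_mul_left hp.pos this
  have : IsCyclic C := by
    refine isCyclic_of_injective_ringHom (((Units.coeHom R).comp f).comp C.subtype) ?_
    rw [injective_iff_map_eq_one]
    rintro ⟨a, ha⟩ h
    have h1 : a ∈ N := by
      rw [hN, MonoidHom.mem_ker]
      ext
      simpa using h
    have := hC.disjoint.le_bot ⟨h1, ha⟩
    ext; simpa using this
  have : IsCyclic N := isCyclic_of_prime_card hk
  let e1 : N ≃* Multiplicative (ZMod p) := mulEquivOfCyclicCardEq (by simp [hk])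
  let e2 : C ≃* Multiplicative (ZMod m) :=
    mulEquivOfCyclicCardEq (hCcard.trans (Nat.card_zmod m).symm)
  let e := (SemidirectProduct.mulEquivSubgroup hC).symm
  exact ⟨_, ⟨e.trans (SemidirectProduct.congr' e1 e2)⟩⟩


section basics
variable {p : ℕ} [Fact p.Prime]

abbrev SLp (p : ℕ) := Matrix.SpecialLinearGroup (Fin 2) (ZMod p)

abbrev mkP (p : ℕ) : SLp p →* SLp p ⧸ Subgroup.center (SLp p) :=
  QuotientGroup.mk' (Subgroup.center (SLp p))

theorem two_ne (hp : 2 < p) : (2 : ZMod p) ≠ 0 := by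
  intro h
  have : ((2 : ℕ) : ZMod p) = 0 := by exact_mod_cast h
  rw [ZMod.natCast_eq_zero_iff] at this
  exact absurd (Nat.le_of_dvd (by norm_num) this) (by omega)

theorem det_eq (g : SLp p) : g 0 0 * g 1 1 - g 0 1 * g 1 0 = 1 := by
  have := g.det_coe
  rwa [Matrix.det_fin_two] at this

def mkSL (a b c d : ZMod p) (h : a * d - b * c = 1) : SLp p :=
  ⟨!![a, b; c, d], by rw [Matrix.det_fin_two_of]; exact h⟩

theorem SL_ext {g h : SLp p} (h00 : g 0 0 = h 0 0) (h01 : g 0 1 = h 0 1) (h10 : g 1 0 = h 1 0)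
    (h11 : g 1 1 = h 1 1) : g = h := by
  ext i j
  fin_cases i <;> fin_cases j <;> assumption

theorem mul_entry (g h : SLp p) (i j : Fin 2) : (g * h) i j = g i 0 * h 0 j + g i 1 * h 1 j := by
  simp [Matrix.mul_apply, Fin.sum_univ_two]

theorem inv00 (g : SLp p) : g⁻¹ 0 0 = g 1 1 := by
  rw [Matrix.SpecialLinearGroup.SL2_inv_expl]; rfl
theorem inv01 (g : SLp p) : g⁻¹ 0 1 = - g 0 1 := by
  rw [Matrix.SpecialLinearGroup.SL2_inv_expl]; rfl
theorem inv10 (g : SLp p) : g⁻¹ 1 0 = - g 1 0 := by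
  rw [Matrix.SpecialLinearGroup.SL2_inv_expl]; rfl
theorem inv11 (g : SLp p) : g⁻¹ 1 1 = g 0 0 := by
  rw [Matrix.SpecialLinearGroup.SL2_inv_expl]; rfl

theorem neg_entry (g : SLp p) (i j : Fin 2) : (-g) i j = - g i j := rfl

theorem mem_center_SL {g : SLp p} : g ∈ Subgroup.center (SLp p) ↔ g = 1 ∨ g = -1 := by
  rw [Matrix.SpecialLinearGroup.mem_center_iff]
  constructor
  · rintro ⟨r, hr, hg⟩
    simp only [Fintype.card_fin] at hr
    rcases mul_self_eq_one_iff.1 ((sq r).symm.trans hr) with h | h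
    · left; ext i j; rw [← hg, h]; simp
    · right; ext i j; rw [← hg, h]; fin_cases i <;> fin_cases j <;> simp
  · rintro (rfl | rfl)
    · exact ⟨1, by simp, by simp⟩
    · exact ⟨-1, by simp, by ext i j; fin_cases i <;> fin_cases j <;> simp⟩

theorem one_ne_neg_one (hp : 2 < p) : (1 : SLp p) ≠ -1 := by
  intro h
  have : (1 : SLp p) 0 0 = (-1 : SLp p) 0 0 := by rw [← h]
  rw [neg_entry] at this
  simp at this
  apply two_ne hp
  linear_combination this

theorem card_center (hp : 2 < p) : Nat.card (Subgroup.center (SLp p)) = 2 := by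
  have : ((Subgroup.center (SLp p) : Subgroup (SLp p)) : Set (SLp p)) = {1, -1} := by
    ext g; simp [mem_center_SL]
  rw [← SetLike.coe_sort_coe, this, Nat.card_coe_set_eq, Set.ncard_pair (one_ne_neg_one hp)]

theorem card_map_mk (hp : 2 < p) (T : Subgroup (SLp p)) (hT : Subgroup.center (SLp p) ≤ T) :
    Nat.card (T.map (mkP p)) * 2 = Nat.card T := by
  let f := (mkP p).subgroupMap T
  have h1 := f.ker.index_mul_card
  rw [Subgroup.index_ker, MonoidHom.range_eq_top.2 (MonoidHom.subgroupMap_surjective _ _),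
    Subgroup.card_top, Subgroup.ker_subgroupMap, QuotientGroup.ker_mk',
    Nat.card_congr (Subgroup.subgroupOfEquivOfLe hT).toEquiv, card_center hp] at h1
  exact h1

end basics

section borel
variable {p : ℕ} [Fact p.Prime]

def borelS (p : ℕ) [Fact p.Prime] : Subgroup (SLp p) where
  carrier := {g | g 1 0 = 0}
  mul_mem' := by
    intro a b ha hb
    simp only [Set.mem_ofPred_eq] at *
    rw [mul_entry, ha, hb]; simp
  one_mem' := by simp
  inv_mem' := by
    intro a ha
    simp only [Set.mem_ofPred_eq] at *
    rw [inv10, ha, neg_zero]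

theorem mem_borel {g : SLp p} : g ∈ borelS p ↔ g 1 0 = 0 := Iff.rfl

theorem borel_det (g : borelS p) : g.1 0 0 * g.1 1 1 = 1 := by
  have := det_eq g.1
  rw [mem_borel.1 g.2] at this
  linear_combination this

def borelUnit (g : borelS p) : (ZMod p)ˣ :=
  ⟨g.1 0 0, g.1 1 1, borel_det g, by rw [mul_comm, borel_det]⟩

def borelMk (u : (ZMod p)ˣ) (b : ZMod p) : borelS p :=
  ⟨mkSL (u : ZMod p) b 0 ((u⁻¹ : (ZMod p)ˣ) : ZMod p) (by rw [Units.mul_inv, mul_zero, sub_zero]), mem_borel.2 rfl⟩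

def borelEquiv : borelS p ≃ (ZMod p)ˣ × ZMod p where
  toFun g := (borelUnit g, g.1 0 1)
  invFun x := borelMk x.1 x.2
  left_inv g := by
    apply Subtype.ext
    apply SL_ext
    · rfl
    · rfl
    · exact (mem_borel.1 g.2).symm
    · rfl
  right_inv x := by
    apply Prod.ext
    · ext; rfl
    · rfl

theorem card_borel : Nat.card (borelS p) = (p - 1) * p := by
  rw [Nat.card_congr borelEquiv, Nat.card_prod, Nat.card_zmod, Nat.card_eq_fintype_card,
    ZMod.card_units]

def borelHom : borelS p →* (ZMod p)ˣ where
  toFun g := borelUnit g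
  map_one' := by ext; rfl
  map_mul' g h := by
    ext
    change (g.1 * h.1) 0 0 = g.1 0 0 * h.1 0 0
    rw [mul_entry, mem_borel.1 h.2]; simp

theorem borelHom_surj : Function.Surjective (borelHom (p := p)) := fun u =>
  ⟨borelMk u 0, by ext; rfl⟩

theorem center_le_borel : Subgroup.center (SLp p) ≤ borelS p := by
  intro g hg
  rcases mem_center_SL.1 hg with rfl | rfl <;> simp [mem_borel]

theorem borel_iso (hp : 2 < p) :
    ∃ φ : Multiplicative (ZMod ((p - 1) / 2)) →* MulAut (Multiplicative (ZMod p)),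
          Nonempty (↥((borelS p).map (mkP p)) ≃* SemidirectProduct (Multiplicative (ZMod p))
            (Multiplicative (ZMod ((p - 1) / 2))) φ) := by
  have hpp : p.Prime := Fact.out
  have hodd : p % 2 = 1 := Nat.odd_iff.1 (hpp.odd_of_ne_two (by omega))
  obtain ⟨m, hm⟩ : ∃ m, p = 2 * m + 1 := ⟨p / 2, by omega⟩
  have hm1 : (p - 1) / 2 = m := by omega
  let π := (mkP p).subgroupMap (borelS p)
  have hπ : Function.Surjective π := MonoidHom.subgroupMap_surjective _ _
  let f : borelS p →* (ZMod p)ˣ := (powMonoidHom 2).comp borelHom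
  have hker : π.ker ≤ f.ker := by
    intro g hg
    rw [Subgroup.ker_subgroupMap, QuotientGroup.ker_mk', Subgroup.mem_subgroupOf] at hg
    rw [MonoidHom.mem_ker]
    ext
    change (g.1 0 0) ^ 2 = 1
    rcases mem_center_SL.1 hg with h | h <;> rw [h]
    · simp
    · rw [neg_entry]; simp
  let c := MonoidHom.liftOfSurjective π hπ ⟨f, hker⟩
  have hc : ∀ g, c (π g) = f g := fun g => by
    exact MonoidHom.liftOfRightInverse_comp_apply π _ _ ⟨f, hker⟩ g
  have hrange : c.range = (powMonoidHom 2 : (ZMod p)ˣ →* (ZMod p)ˣ).range := by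
    ext u
    constructor
    · rintro ⟨k, rfl⟩
      obtain ⟨g, rfl⟩ := hπ k
      exact ⟨borelHom g, (hc g).symm⟩
    · rintro ⟨v, rfl⟩
      obtain ⟨g, rfl⟩ := borelHom_surj v
      exact ⟨π g, hc g⟩
  have hcr : Nat.card c.range = m := by
    rw [hrange, IsCyclic.card_powMonoidHom_range, Nat.card_eq_fintype_card, ZMod.card_units, hm]
    simp
  have hcard : Nat.card ((borelS p).map (mkP p)) = p * m := by
    have := card_map_mk hp (borelS p) center_le_borel
    rw [card_borel] at this
    have h2 : p - 1 = 2 * m := by omega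
    rw [h2] at this
    linarith
  rw [hm1]
  refine semidirect_recog p m hpp ?_ hcard c ?_
  · rw [hm]; simp
  · have h1 := c.ker.card_mul_index
    rw [Subgroup.index_ker, hcr, hcard] at h1
    exact Nat.eq_of_mul_eq_mul_right (by omega) h1

end borel


section dihedral
variable {p : ℕ} [Fact p.Prime]

theorem conic_card_split (hp : 2 < p) (s : ZMod p) (hs : s ≠ 0) :
    Nat.card {v : ZMod p × ZMod p // v.1 ^ 2 - s ^ 2 * v.2 ^ 2 = 1} = p - 1 := by
  have h2 := two_ne hp
  let e : {v : ZMod p × ZMod p // v.1 ^ 2 - s ^ 2 * v.2 ^ 2 = 1} ≃ (ZMod p)ˣ :=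
    { toFun := fun v => ⟨v.1.1 + s * v.1.2, v.1.1 - s * v.1.2,
        by linear_combination v.2, by linear_combination v.2⟩
      invFun := fun u => ⟨(((u : ZMod p) + (u : ZMod p)⁻¹) / 2,
        ((u : ZMod p) - (u : ZMod p)⁻¹) / (2 * s)), by
          have := u.ne_zero
          field_simp
          ring⟩
      left_inv := by
        rintro ⟨⟨x, y⟩, h⟩
        simp only at h
        have h1 : (x + s * y)⁻¹ = x - s * y := by
          apply inv_eq_of_mul_eq_one_right
          linear_combination h
        apply Subtype.ext
        simp only [h1]
        apply Prod.ext
        · simp only; field_simp; ring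
        · simp only; field_simp; ring
      right_inv := by
        intro u
        ext
        have := u.ne_zero
        simp only
        field_simp
        ring }
  rw [Nat.card_congr e, Nat.card_eq_fintype_card, ZMod.card_units]

theorem conic_card_nonsplit (hp : 2 < p) (D : ZMod p) (hD : ¬ IsSquare D) :
    Nat.card {v : ZMod p × ZMod p // v.1 ^ 2 - D * v.2 ^ 2 = 1} = p + 1 := by
  have h2 := two_ne hp
  have hden : ∀ m : ZMod p, 1 - D * m ^ 2 ≠ 0 := by
    intro m h
    apply hD
    have hm : m ≠ 0 := by rintro rfl; simp at h
    exact ⟨m⁻¹, by field_simp; linear_combination -h⟩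
  have hD0 : D ≠ 0 := by rintro rfl; exact hD (IsSquare.zero)
  let f : Option (ZMod p) → {v : ZMod p × ZMod p // v.1 ^ 2 - D * v.2 ^ 2 = 1} := fun o =>
    match o with
    | none => ⟨(-1, 0), by simp⟩
    | some m => ⟨((1 + D * m ^ 2) / (1 - D * m ^ 2), 2 * m / (1 - D * m ^ 2)), by
        have := hden m
        field_simp
        ring⟩
  have hx : ∀ m : ZMod p, (1 + D * m ^ 2) / (1 - D * m ^ 2) + 1 ≠ 0 := by
    intro m h
    have := hden m
    field_simp at h
    apply h2; linear_combination h
  have hf : Function.Bijective f := by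
    constructor
    · rintro (_ | m) (_ | m') h
      · rfl
      · exfalso
        have := congrArg (fun v => v.1.1) h
        simp only [f] at this
        apply hx m'; rw [← this]; ring
      · exfalso
        have := congrArg (fun v => v.1.1) h
        simp only [f] at this
        apply hx m; rw [this]; ring
      · have e1 := congrArg (fun v => v.1.1) h
        have e2 := congrArg (fun v => v.1.2) h
        simp only [f] at e1 e2
        have d1 := hden m
        have d2 := hden m'
        have k1 : 2 * m / (1 - D * m ^ 2) = m * ((1 + D * m ^ 2) / (1 - D * m ^ 2) + 1) := by
          rw [div_add_one d1, ← mul_div_assoc]; congr 1; ring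
        have k2 : 2 * m' / (1 - D * m' ^ 2) = m' * ((1 + D * m' ^ 2) / (1 - D * m' ^ 2) + 1) := by
          rw [div_add_one d2, ← mul_div_assoc]; congr 1; ring
        rw [k1, k2, e1] at e2
        rw [mul_right_cancel₀ (hx m') e2]
    · rintro ⟨⟨x, y⟩, h⟩
      simp only at h
      by_cases hx1 : x + 1 = 0
      · refine ⟨none, Subtype.ext ?_⟩
        have hx' : x = -1 := by linear_combination hx1
        subst hx'
        have : D * y ^ 2 = 0 := by linear_combination -h
        have hy : y = 0 := by simpa [hD0] using this
        subst hy; rfl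
      · refine ⟨some (y / (x + 1)), Subtype.ext ?_⟩
        have hk : 1 - D * (y / (x + 1)) ^ 2 = 2 / (x + 1) := by
          field_simp
          linear_combination h
        have hk2 : 1 + D * (y / (x + 1)) ^ 2 = 2 * x / (x + 1) := by
          field_simp
          linear_combination -h
        simp only [f, hk, hk2]
        apply Prod.ext
        · simp only; field_simp
        · simp only; field_simp
  rw [← Nat.card_congr (Equiv.ofBijective f hf), Nat.card_eq_fintype_card, Fintype.card_option,
    ZMod.card]

/-- trace zero matrix -/
def tz (α β γ : ZMod p) : Matrix (Fin 2) (Fin 2) (ZMod p) := !![α, β; γ, -α]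

def cent (M : Matrix (Fin 2) (Fin 2) (ZMod p)) : Subgroup (SLp p) where
  carrier := {g | (g : Matrix (Fin 2) (Fin 2) (ZMod p)) * M = M * g}
  mul_mem' := by
    intro a b ha hb
    simp only [Set.mem_ofPred_eq, Matrix.SpecialLinearGroup.coe_mul] at *
    rw [mul_assoc, hb, ← mul_assoc, ha, mul_assoc]
  one_mem' := by simp
  inv_mem' := by
    intro a ha
    simp only [Set.mem_ofPred_eq] at *
    have h1 : ((a⁻¹ : SLp p) : Matrix (Fin 2) (Fin 2) (ZMod p)) * a = 1 := by
      rw [← Matrix.SpecialLinearGroup.coe_mul, inv_mul_cancel, Matrix.SpecialLinearGroup.coe_one]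
    have h2 : (a : Matrix (Fin 2) (Fin 2) (ZMod p)) * ((a⁻¹ : SLp p) : Matrix _ _ _) = 1 := by
      rw [← Matrix.SpecialLinearGroup.coe_mul, mul_inv_cancel, Matrix.SpecialLinearGroup.coe_one]
    calc ((a⁻¹ : SLp p) : Matrix (Fin 2) (Fin 2) (ZMod p)) * M
        = (a⁻¹ : SLp p) * (M * a) * (a⁻¹ : SLp p) := by
          rw [mul_assoc, mul_assoc, h2, mul_one]
      _ = _ := by rw [← ha, ← mul_assoc, h1, one_mul]

def dcent (M : Matrix (Fin 2) (Fin 2) (ZMod p)) : Subgroup (SLp p) where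
  carrier := {g | (g : Matrix (Fin 2) (Fin 2) (ZMod p)) * M = M * g ∨
    (g : Matrix (Fin 2) (Fin 2) (ZMod p)) * M = -(M * g)}
  mul_mem' := by
    intro a b ha hb
    simp only [Set.mem_ofPred_eq, Matrix.SpecialLinearGroup.coe_mul] at *
    rcases ha with ha | ha <;> rcases hb with hb | hb <;> rw [mul_assoc, hb]
    · rw [← mul_assoc, ha, mul_assoc]; simp
    · rw [mul_neg, ← mul_assoc, ha, mul_assoc]; simp
    · rw [← mul_assoc, ha, neg_mul, mul_assoc]; simp
    · rw [mul_neg, ← mul_assoc, ha, neg_mul, mul_assoc]; simp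
  one_mem' := by simp
  inv_mem' := by
    intro a ha
    simp only [Set.mem_ofPred_eq] at *
    have h1 : ((a⁻¹ : SLp p) : Matrix (Fin 2) (Fin 2) (ZMod p)) * a = 1 := by
      rw [← Matrix.SpecialLinearGroup.coe_mul, inv_mul_cancel, Matrix.SpecialLinearGroup.coe_one]
    have h2 : (a : Matrix (Fin 2) (Fin 2) (ZMod p)) * ((a⁻¹ : SLp p) : Matrix _ _ _) = 1 := by
      rw [← Matrix.SpecialLinearGroup.coe_mul, mul_inv_cancel, Matrix.SpecialLinearGroup.coe_one]
    have h3 : ((a⁻¹ : SLp p) : Matrix (Fin 2) (Fin 2) (ZMod p)) * M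
        = (a⁻¹ : SLp p) * (M * a) * (a⁻¹ : SLp p) := by
          rw [mul_assoc, mul_assoc, h2, mul_one]
    have h4 : M * ((a⁻¹ : SLp p) : Matrix (Fin 2) (Fin 2) (ZMod p))
        = (a⁻¹ : SLp p) * (a * M) * (a⁻¹ : SLp p) := by
          rw [← mul_assoc _ _ M, h1, one_mul]
    rw [h3, h4]
    rcases ha with ha | ha <;> rw [ha]
    · left; rfl
    · right; simp

theorem mem_cent {M : Matrix (Fin 2) (Fin 2) (ZMod p)} {g : SLp p} : g ∈ cent M ↔
    (g : Matrix (Fin 2) (Fin 2) (ZMod p)) * M = M * g := Iff.rfl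

theorem mem_dcent {M : Matrix (Fin 2) (Fin 2) (ZMod p)} {g : SLp p} : g ∈ dcent M ↔
    (g : Matrix (Fin 2) (Fin 2) (ZMod p)) * M = M * g ∨
    (g : Matrix (Fin 2) (Fin 2) (ZMod p)) * M = -(M * g) := Iff.rfl

theorem cent_le_dcent (M : Matrix (Fin 2) (Fin 2) (ZMod p)) : cent M ≤ dcent M :=
  fun _ h => Or.inl h

theorem center_le_cent (M : Matrix (Fin 2) (Fin 2) (ZMod p)) :
    Subgroup.center (SLp p) ≤ cent M := by
  intro g hg
  rcases mem_center_SL.1 hg with rfl | rfl <;> simp [mem_cent]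

theorem mat_eq_iff (A B : Matrix (Fin 2) (Fin 2) (ZMod p)) :
    A = B ↔ A 0 0 = B 0 0 ∧ A 0 1 = B 0 1 ∧ A 1 0 = B 1 0 ∧ A 1 1 = B 1 1 := by
  constructor
  · rintro rfl; simp
  · rintro ⟨h1, h2, h3, h4⟩
    ext i j
    fin_cases i <;> fin_cases j <;> assumption

theorem comm_iff (α β γ : ZMod p) (g : Matrix (Fin 2) (Fin 2) (ZMod p)) :
    g * tz α β γ = tz α β γ * g ↔
      g 0 1 * γ = β * g 1 0 ∧ β * (g 0 0 - g 1 1) = 2 * α * g 0 1 ∧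
      γ * (g 0 0 - g 1 1) = 2 * α * g 1 0 := by
  rw [mat_eq_iff]
  simp only [tz, Matrix.mul_apply, Fin.sum_univ_two, Matrix.of_apply, Matrix.cons_val', Matrix.cons_val_zero,
    Matrix.cons_val_one, Matrix.cons_val_fin_one]
  constructor
  · rintro ⟨h1, h2, h3, h4⟩
    exact ⟨by linear_combination h1, by linear_combination h2, by linear_combination -h3⟩
  · rintro ⟨h1, h2, h3⟩
    exact ⟨by linear_combination h1, by linear_combination h2, by linear_combination -h3,
      by linear_combination -h1⟩

theorem anti_iff (hp : 2 < p) (α β γ : ZMod p) (hD : α ^ 2 + β * γ ≠ 0)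
    (g : Matrix (Fin 2) (Fin 2) (ZMod p)) :
    g * tz α β γ = -(tz α β γ * g) ↔
      g 0 0 + g 1 1 = 0 ∧ 2 * g 0 0 * α + g 0 1 * γ + g 1 0 * β = 0 := by
  rw [mat_eq_iff]
  simp only [tz, Matrix.neg_apply, Matrix.mul_apply, Fin.sum_univ_two, Matrix.of_apply, Matrix.cons_val',
    Matrix.cons_val_zero, Matrix.cons_val_one, Matrix.cons_val_fin_one]
  constructor
  · rintro ⟨h1, h2, h3, h4⟩
    refine ⟨?_, by linear_combination h1⟩
    have : 2 * ((α ^ 2 + β * γ) * (g 0 0 + g 1 1)) = 0 := by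
      linear_combination α * h1 - α * h4 + 2 * γ * h2
    simpa [hD, two_ne hp] using this
  · rintro ⟨h1, h2⟩
    exact ⟨by linear_combination h2, by linear_combination β * h1, by linear_combination γ * h1,
      by linear_combination h2 - 2 * α * h1⟩

theorem exists_neg_one_rep (hp : 2 < p) (D : ZMod p) (hD : D ≠ 0) : ∃ x y : ZMod p,
    x ^ 2 - D * y ^ 2 = -1 := by
  obtain ⟨a, b, h⟩ := FiniteField.exists_root_sum_quadratic (R := ZMod p)
    (f := Polynomial.C 1 * Polynomial.X ^ 2 + Polynomial.C 0 * Polynomial.X + Polynomial.C 1)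
    (g := Polynomial.C (-D) * Polynomial.X ^ 2 + Polynomial.C 0 * Polynomial.X + Polynomial.C 0)
    (Polynomial.degree_quadratic one_ne_zero) (Polynomial.degree_quadratic (neg_ne_zero.2 hD))
    (by rw [ZMod.card]; exact Nat.odd_iff.1 ((Fact.out : p.Prime).odd_of_ne_two (by omega)))
  refine ⟨a, b, ?_⟩
  simp at h
  linear_combination h

theorem exists_anti (hp : 2 < p) (α β γ : ZMod p) (hD : α ^ 2 + β * γ ≠ 0) :
    ∃ w : SLp p, (w : Matrix (Fin 2) (Fin 2) (ZMod p)) * tz α β γ = -(tz α β γ * w) := by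
  obtain ⟨X, Y, h⟩ := exists_neg_one_rep hp _ hD
  by_cases hβ : β = 0
  · by_cases hγ : γ = 0
    · refine ⟨mkSL 0 1 (-1) 0 (by ring), (anti_iff hp α β γ hD _).2 ?_⟩
      simp [mkSL, hβ, hγ]
    · refine ⟨mkSL (X + α * Y) (-(2 * α * X + 2 * α ^ 2 * Y + γ * β * Y) / γ) (γ * Y)
        (-(X + α * Y)) (by field_simp; linear_combination -h), (anti_iff hp α β γ hD _).2 ?_⟩
      simp [mkSL]
      field_simp
      ring
  · refine ⟨mkSL (X + α * Y) (β * Y) (-(2 * α * X + 2 * α ^ 2 * Y + γ * β * Y) / β)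
        (-(X + α * Y)) (by field_simp; linear_combination -h), (anti_iff hp α β γ hD _).2 ?_⟩
    simp [mkSL]
    field_simp
    ring

theorem tr0_sq {g : SLp p} (h : g 0 0 + g 1 1 = 0) : g * g = -1 := by
  have hd := det_eq g
  apply SL_ext <;> rw [mul_entry, neg_entry] <;> simp
  · linear_combination -hd + g 0 0 * h
  · linear_combination g 0 1 * h
  · linear_combination g 1 0 * h
  · linear_combination -hd + g 1 1 * h

end dihedral


section dihedral2
variable {p : ℕ} [Fact p.Prime]

def cX (g : SLp p) : ZMod p := (g 0 0 + g 1 1) / 2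
def cY (α β γ : ZMod p) (g : SLp p) : ZMod p :=
  (α * (g 0 0 - g 1 1) + g 0 1 * γ + g 1 0 * β) / (2 * (α ^ 2 + β * γ))

theorem comm_form (hp : 2 < p) (α β γ : ZMod p) (hD : α ^ 2 + β * γ ≠ 0) (g : SLp p)
    (hg : g ∈ cent (tz α β γ)) :
    g 0 0 = cX g + cY α β γ g * α ∧ g 0 1 = cY α β γ g * β ∧ g 1 0 = cY α β γ g * γ ∧
    g 1 1 = cX g - cY α β γ g * α := by
  obtain ⟨h1, h2, h3⟩ := (comm_iff _ _ _ _).1 hg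
  have := two_ne hp
  have hX : 2 * cX g = g 0 0 + g 1 1 := by rw [cX]; field_simp
  have hY : 2 * (α ^ 2 + β * γ) * cY α β γ g = α * (g 0 0 - g 1 1) + g 0 1 * γ + g 1 0 * β := by
    rw [cY, mul_div_cancel₀]
    exact mul_ne_zero this hD
  have h2D : 2 * (α ^ 2 + β * γ) ≠ 0 := mul_ne_zero this hD
  refine ⟨?_, ?_, ?_, ?_⟩ <;> apply mul_left_cancel₀ h2D
  · linear_combination -(α ^ 2 + β * γ) * hX - α * hY + γ * h2 + α * h1
  · linear_combination -β * hY - α * h2 + β * h1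
  · linear_combination -γ * hY - α * h3 - γ * h1
  · linear_combination -(α ^ 2 + β * γ) * hX + α * hY - γ * h2 - α * h1

theorem cX_form (hp : 2 < p) (α x y : ZMod p) (g : SLp p)
    (h1 : g 0 0 = x + y * α) (h4 : g 1 1 = x - y * α) : cX g = x := by
  have := two_ne hp
  rw [cX, h1, h4]; field_simp; ring

theorem cY_form (hp : 2 < p) (α β γ : ZMod p) (hD : α ^ 2 + β * γ ≠ 0) (x y : ZMod p) (g : SLp p)
    (h1 : g 0 0 = x + y * α) (h2 : g 0 1 = y * β) (h3 : g 1 0 = y * γ) (h4 : g 1 1 = x - y * α) :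
    cY α β γ g = y := by
  have := two_ne hp
  rw [cY, h1, h2, h3, h4]; field_simp; ring

def centEquiv (hp : 2 < p) (α β γ : ZMod p) (hD : α ^ 2 + β * γ ≠ 0) :
    cent (tz α β γ) ≃ {v : ZMod p × ZMod p // v.1 ^ 2 - (α ^ 2 + β * γ) * v.2 ^ 2 = 1} where
  toFun g := ⟨(cX g.1, cY α β γ g.1), by
    obtain ⟨h1, h2, h3, h4⟩ := comm_form hp α β γ hD g.1 g.2
    have := det_eq g.1
    rw [h1, h2, h3, h4] at this
    linear_combination this⟩
  invFun v := ⟨mkSL (v.1.1 + v.1.2 * α) (v.1.2 * β) (v.1.2 * γ) (v.1.1 - v.1.2 * α)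
    (by linear_combination v.2), (comm_iff _ _ _ _).2 (by simp [mkSL]; grind)⟩
  left_inv g := by
    obtain ⟨h1, h2, h3, h4⟩ := comm_form hp α β γ hD g.1 g.2
    apply Subtype.ext
    exact SL_ext h1.symm h2.symm h3.symm h4.symm
  right_inv v := by
    apply Subtype.ext
    apply Prod.ext
    · exact cX_form hp α _ v.1.2 _ rfl rfl
    · exact cY_form hp α β γ hD v.1.1 _ _ rfl rfl rfl rfl

theorem cent_cyclic (hp : 2 < p) (α β γ : ZMod p) (hD : α ^ 2 + β * γ ≠ 0) :
    IsCyclic (cent (tz α β γ)) := by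
  let E := AlgebraicClosure (ZMod p)
  let ι := algebraMap (ZMod p) E
  obtain ⟨s, hs⟩ := IsAlgClosed.exists_pow_nat_eq (ι (α ^ 2 + β * γ)) (n := 2) (by norm_num)
  have hι2 : (2 : E) ≠ 0 := by
    intro h
    apply two_ne hp
    apply ι.injective
    rw [map_ofNat, map_zero, h]
  have hs0 : s ≠ 0 := by
    rintro rfl
    apply hD
    apply ι.injective
    rw [map_zero, ← hs]
    norm_num
  let f : cent (tz α β γ) →* E :=
    { toFun := fun g => ι (cX g.1) + s * ι (cY α β γ g.1)
      map_one' := by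
        change ι (cX (1 : SLp p)) + s * ι (cY α β γ (1 : SLp p)) = 1
        rw [cX_form hp α 1 0 (1 : SLp p) (by simp) (by simp),
          cY_form hp α β γ hD 1 0 (1 : SLp p) (by simp) (by simp) (by simp) (by simp)]
        simp
      map_mul' := by
        rintro ⟨g, hg⟩ ⟨h, hh⟩
        obtain ⟨g1, g2, g3, g4⟩ := comm_form hp α β γ hD g hg
        obtain ⟨h1, h2, h3, h4⟩ := comm_form hp α β γ hD h hh
        have e1 : (g * h) 0 0 = (cX g * cX h + (α ^ 2 + β * γ) * (cY α β γ g * cY α β γ h)) +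
          (cX g * cY α β γ h + cX h * cY α β γ g) * α := by
          rw [mul_entry, g1, g2, h1, h3]; ring
        have e2 : (g * h) 0 1 = (cX g * cY α β γ h + cX h * cY α β γ g) * β := by
          rw [mul_entry, g1, g2, h2, h4]; ring
        have e3 : (g * h) 1 0 = (cX g * cY α β γ h + cX h * cY α β γ g) * γ := by
          rw [mul_entry, g3, g4, h1, h3]; ring
        have e4 : (g * h) 1 1 = (cX g * cX h + (α ^ 2 + β * γ) * (cY α β γ g * cY α β γ h)) -
          (cX g * cY α β γ h + cX h * cY α β γ g) * α := by
          rw [mul_entry, g3, g4, h2, h4]; ring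
        change ι (cX (g * h)) + s * ι (cY α β γ (g * h)) = _
        rw [cX_form hp α _ _ _ e1 e4, cY_form hp α β γ hD _ _ _ e1 e2 e3 e4]
        simp only [map_add ι, map_mul ι] at hs ⊢
        linear_combination (-(ι (cY α β γ g)) * ι (cY α β γ h)) * hs }
  refine isCyclic_of_injective_ringHom f ?_
  rw [injective_iff_map_eq_one]
  rintro ⟨g, hg⟩ h
  change ι (cX g) + s * ι (cY α β γ g) = 1 at h
  obtain ⟨h1, h2, h3, h4⟩ := comm_form hp α β γ hD g hg
  have hdet := det_eq g
  rw [h1, h2, h3, h4] at hdet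
  have hdet' : cX g * cX g - (α ^ 2 + β * γ) * (cY α β γ g * cY α β γ g) = 1 := by
    linear_combination hdet
  have hd2 := congrArg ι hdet'
  rw [map_sub, map_mul, map_mul ι (α ^ 2 + β * γ), ← hs, map_mul, map_one] at hd2
  have hconj : ι (cX g) - s * ι (cY α β γ g) = 1 := by
    linear_combination hd2 - (ι (cX g) - s * ι (cY α β γ g)) * h
  have hy : 2 * (s * ι (cY α β γ g)) = 0 := by linear_combination h - hconj
  have hy0 : cY α β γ g = 0 := by
    simpa [hι2, hs0] using hy
  have hx : cX g = 1 := by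
    rw [hy0] at h
    simp only [map_zero, mul_zero, add_zero] at h
    apply ι.injective
    rw [h, map_one]
  apply Subtype.ext
  rw [hx, hy0] at h1 h4
  rw [hy0] at h2 h3
  apply SL_ext <;> simp [h1, h2, h3, h4]

theorem mkP_neg (g : SLp p) : mkP p (-g) = mkP p g := by
  rw [QuotientGroup.mk'_apply, QuotientGroup.mk'_apply, QuotientGroup.eq, mem_center_SL]
  right
  apply SL_ext <;> simp

theorem mkP_eq {g h : SLp p} (e : mkP p g = mkP p h) : h = g ∨ h = -g := by
  rw [QuotientGroup.mk'_apply, QuotientGroup.mk'_apply, QuotientGroup.eq, mem_center_SL] at e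
  rcases e with e | e
  · left; rw [inv_mul_eq_one] at e; exact e.symm
  · right; rw [inv_mul_eq_iff_eq_mul] at e; rw [e]; simp

theorem dcent_iso (hp : 2 < p) (α β γ : ZMod p) (hD : α ^ 2 + β * γ ≠ 0) (n : ℕ)
    (hn : Nat.card {v : ZMod p × ZMod p // v.1 ^ 2 - (α ^ 2 + β * γ) * v.2 ^ 2 = 1} = n * 2) :
    Nonempty (↥((dcent (tz α β γ)).map (mkP p)) ≃* DihedralGroup n) := by
  set M := tz α β γ with hM
  obtain ⟨w, hw⟩ := exists_anti hp α β γ hD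
  rw [← hM] at hw
  have hle : (cent M).map (mkP p) ≤ (dcent M).map (mkP p) := Subgroup.map_mono (cent_le_dcent M)
  let C := ((cent M).map (mkP p)).subgroupOf ((dcent M).map (mkP p))
  have eC : C ≃* (cent M).map (mkP p) := Subgroup.subgroupOfEquivOfLe hle
  have := cent_cyclic hp α β γ hD
  have hcyc : IsCyclic ((cent M).map (mkP p)) :=
    isCyclic_of_surjective _ (MonoidHom.subgroupMap_surjective (mkP p) (cent M))
  have hcycC : IsCyclic C := isCyclic_of_surjective eC.symm eC.symm.surjective
  have hcard : Nat.card C = n := by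
    rw [Nat.card_congr eC.toEquiv]
    have h1 := card_map_mk hp (cent M) (center_le_cent M)
    rw [Nat.card_congr (centEquiv hp α β γ hD), hn] at h1
    omega
  have hanti : ∀ g : SLp p, (g : Matrix (Fin 2) (Fin 2) (ZMod p)) * M = -(M * g) → g * g = -1 :=
    fun g hg => tr0_sq ((anti_iff hp α β γ hD _).1 hg).1
  have hwd : w ∈ dcent M := Or.inr hw
  have hM0 : ∀ g : SLp p, (g : Matrix (Fin 2) (Fin 2) (ZMod p)) * M = -(M * g) → g ∉ cent M := by
    intro g h1 h2
    rw [mem_cent] at h2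
    have e1 := (anti_iff hp α β γ hD _).1 h1
    have e2 := comm_form hp α β γ hD g h2
    have hx : cX g = 0 := by rw [cX, e1.1, zero_div]
    have hy : cY α β γ g = 0 := by
      rw [cY, div_eq_zero_iff]; left
      linear_combination e1.2 - α * e1.1
    rw [hx, hy] at e2
    have := det_eq g
    rw [e2.1, e2.2.1] at this
    simp at this
  refine dihedral_recog n C hcard ⟨mkP p w, Subgroup.mem_map_of_mem _ hwd⟩ ?_ ?_ ?_ ?_
  · rw [Subgroup.mem_subgroupOf]
    rintro ⟨c, hc, h⟩
    rcases mkP_eq h with h | h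
    · exact hM0 w hw (h ▸ hc)
    · apply hM0 w hw
      rw [h, ← neg_one_mul]
      exact mul_mem (center_le_cent M (mem_center_SL.2 (Or.inr rfl))) hc
  · apply Subtype.ext
    change mkP p w * mkP p w = 1
    rw [← map_mul, hanti w hw, mkP_neg, map_one]
  · rintro ⟨_, _⟩ hc
    rw [Subgroup.mem_subgroupOf] at hc
    obtain ⟨c, hc, rfl⟩ := hc
    apply Subtype.ext
    change mkP p w * mkP p c * mkP p w = (mkP p c)⁻¹
    have h1 : (c * w) * (c * w) = -1 := by
      apply hanti
      rw [Matrix.SpecialLinearGroup.coe_mul, mul_assoc, hw, mul_neg, ← mul_assoc, mem_cent.1 hc,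
        mul_assoc]
    apply eq_inv_of_mul_eq_one_right
    rw [← map_mul, ← map_mul, ← map_mul, ← map_one (mkP p), ← mkP_neg 1, ← h1]
    simp only [mul_assoc]
  · rintro ⟨_, g, hg, rfl⟩
    simp only [C, Subgroup.mem_subgroupOf]
    rcases hg with hg | hg
    · left; exact ⟨g, hg, rfl⟩
    · right
      refine ⟨w * g, ?_, map_mul _ _ _⟩
      change ((w * g : SLp p) : Matrix (Fin 2) (Fin 2) (ZMod p)) * M = M * (w * g : SLp p)
      rw [Matrix.SpecialLinearGroup.coe_mul, mul_assoc, hg, mul_neg, ← mul_assoc, hw, neg_mul,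
        neg_neg, mul_assoc]

end dihedral2


section quat
variable {p : ℕ} [Fact p.Prime]

abbrev Mp (p : ℕ) := Matrix (Fin 2) (Fin 2) (ZMod p)

/-- A quaternion pair of matrices. -/
structure QPair (I J : Mp p) : Prop where
  hI : I * I = -1
  hJ : J * J = -1
  hJI : J * I = -(I * J)

def qv (I J : Mp p) (x y z : ZMod p) : Mp p := x • I + y • J + z • (I * J)

namespace QPair
variable {I J : Mp p}

theorem IK (h : QPair I J) : I * (I * J) = -J := by rw [← mul_assoc, h.hI, neg_one_mul]
theorem KJ (h : QPair I J) : (I * J) * J = -I := by rw [mul_assoc, h.hJ, mul_neg_one]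
theorem KI (h : QPair I J) : (I * J) * I = J := by rw [mul_assoc, h.hJI, mul_neg, h.IK, neg_neg]
theorem JK (h : QPair I J) : J * (I * J) = I := by rw [← mul_assoc, h.hJI, neg_mul, h.KJ, neg_neg]
theorem KK (h : QPair I J) : (I * J) * (I * J) = -1 := by rw [mul_assoc, h.JK, h.hI]

theorem qv_zero (h : QPair I J) (hp : 2 < p) {x y z : ZMod p} (hq : qv I J x y z = 0) :
    x = 0 ∧ y = 0 ∧ z = 0 := by
  have key : ∀ c : ZMod p, (-(2 * c)) • (1 : Mp p) = 0 → c = 0 := by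
    intro c hc
    have := congrFun (congrFun hc 0) 0
    simpa [two_ne hp] using this
  refine ⟨key x ?_, key y ?_, key z ?_⟩
  · have e : I * qv I J x y z + qv I J x y z * I = (-(2 * x)) • (1 : Mp p) := by
      simp only [qv, mul_add, add_mul, mul_smul_comm, smul_mul_assoc, h.hI, h.hJI, h.IK, h.KI]
      module
    rw [← e, hq]; simp
  · have e : J * qv I J x y z + qv I J x y z * J = (-(2 * y)) • (1 : Mp p) := by
      simp only [qv, mul_add, add_mul, mul_smul_comm, smul_mul_assoc, h.hJ, h.hJI, h.JK, h.KJ]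
      module
    rw [← e, hq]; simp
  · have e : (I * J) * qv I J x y z + qv I J x y z * (I * J) = (-(2 * z)) • (1 : Mp p) := by
      simp only [qv, mul_add, add_mul, mul_smul_comm, smul_mul_assoc, h.KI, h.KJ, h.JK, h.IK, h.KK]
      module
    rw [← e, hq]; simp

theorem qv_inj (h : QPair I J) (hp : 2 < p) {x y z x' y' z' : ZMod p} (hq : qv I J x y z = qv I J x' y' z') :
    x = x' ∧ y = y' ∧ z = z' := by
  have : qv I J (x - x') (y - y') (z - z') = 0 := by
    rw [← sub_eq_zero] at hq
    rw [← hq]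
    simp only [qv]; module
  obtain ⟨h1, h2, h3⟩ := h.qv_zero hp this
  exact ⟨sub_eq_zero.1 h1, sub_eq_zero.1 h2, sub_eq_zero.1 h3⟩

end QPair

def sg1 : Fin 4 → ZMod p := ![1, 1, -1, -1]
def sg2 : Fin 4 → ZMod p := ![1, -1, 1, -1]
def sg3 : Fin 4 → ZMod p := ![1, -1, -1, 1]

def dg (I J : Mp p) (m : Fin 4) : Mp p := qv I J (sg1 m) (sg2 m) (sg3 m)

theorem SL_cancel {A B : Mp p} {g : SLp p} (e : A * (g : Mp p) = B * g) : A = B := by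
  have h2 : (g : Mp p) * ((g⁻¹ : SLp p) : Mp p) = 1 := by
    rw [← Matrix.SpecialLinearGroup.coe_mul, mul_inv_cancel, Matrix.SpecialLinearGroup.coe_one]
  have := congrArg (fun X => X * ((g⁻¹ : SLp p) : Mp p)) e
  simpa only [mul_assoc, h2, mul_one] using this

theorem one_ne_neg (hp : 2 < p) : (1 : ZMod p) ≠ -1 := by
  intro h; apply two_ne hp; linear_combination h

theorem dg_uniq {I J : Mp p} (h : QPair I J) (hp : 2 < p) {m n : Fin 4}
    (e : dg I J m = dg I J n ∨ dg I J m = - dg I J n) : m = n := by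
  have h1 := one_ne_neg hp
  have h2 := h1.symm
  have hneg : - dg I J n = qv I J (-sg1 n) (-sg2 n) (-sg3 n) := by
    simp only [dg, qv]; module
  rw [hneg] at e
  rcases e with e | e <;> have e := h.qv_inj hp e <;> clear hneg <;> revert e <;>
    fin_cases m <;> fin_cases n <;> simp [sg1, sg2, sg3, h1, h2]

/-- `g` maps the diagonal `m` to the diagonal `n`. -/
def mapsD (I J : Mp p) (g : SLp p) (m n : Fin 4) : Prop :=
  (g : Mp p) * dg I J m = dg I J n * g ∨ (g : Mp p) * dg I J m = -(dg I J n * g)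

theorem mapsD_mul {I J : Mp p} {g g' : SLp p} {m n r : Fin 4} (h1 : mapsD I J g' m n)
    (h2 : mapsD I J g n r) : mapsD I J (g * g') m r := by
  unfold mapsD at *
  rw [Matrix.SpecialLinearGroup.coe_mul]
  rcases h1 with h1 | h1 <;> rcases h2 with h2 | h2 <;> rw [mul_assoc, h1]
  · left; rw [← mul_assoc, h2, mul_assoc]
  · right; rw [← mul_assoc, h2, neg_mul, mul_assoc]
  · right; rw [mul_neg, ← mul_assoc, h2, mul_assoc]
  · left; rw [mul_neg, ← mul_assoc, h2, neg_mul, neg_neg, mul_assoc]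

theorem mapsD_one {I J : Mp p} (m : Fin 4) : mapsD I J 1 m m := by
  left; simp

theorem mapsD_uniq {I J : Mp p} (h : QPair I J) (hp : 2 < p) {g : SLp p} {m n n' : Fin 4}
    (h1 : mapsD I J g m n) (h2 : mapsD I J g m n') : n = n' := by
  apply dg_uniq h hp
  rcases h1 with h1 | h1 <;> rcases h2 with h2 | h2 <;> rw [h1] at h2
  · left; exact SL_cancel h2
  · right; rw [← neg_mul] at h2; exact SL_cancel h2
  · right; rw [neg_eq_iff_eq_neg, ← neg_mul] at h2; exact SL_cancel h2
  · left; exact SL_cancel (neg_injective h2)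

def octa (I J : Mp p) : Subgroup (SLp p) where
  carrier := {g | ∀ m, ∃ n, mapsD I J g m n}
  mul_mem' := by
    intro a b ha hb m
    obtain ⟨n, hn⟩ := hb m
    obtain ⟨r, hr⟩ := ha n
    exact ⟨r, mapsD_mul hn hr⟩
  one_mem' := fun m => ⟨m, mapsD_one m⟩
  inv_mem' := by
    intro a ha m
    have hpow : ∀ k : ℕ, ∀ m, ∃ n, mapsD I J (a ^ k) m n := by
      intro k
      induction k with
      | zero => intro m; exact ⟨m, by rw [pow_zero]; exact mapsD_one m⟩
      | succ k ih =>
        intro m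
        obtain ⟨n, hn⟩ := ha m
        obtain ⟨r, hr⟩ := ih n
        exact ⟨r, by rw [pow_succ]; exact mapsD_mul hn hr⟩
    have : a⁻¹ = a ^ (orderOf a - 1) := by
      rw [inv_eq_iff_mul_eq_one, ← pow_succ', Nat.sub_add_cancel (orderOf_pos a), pow_orderOf_eq_one]
    rw [this]
    exact hpow _ m

noncomputable def octaFun (I J : Mp p) (g : octa I J) (m : Fin 4) : Fin 4 := (g.2 m).choose

theorem octaFun_spec (I J : Mp p) (g : octa I J) (m : Fin 4) : mapsD I J g.1 m (octaFun I J g m) :=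
  (g.2 m).choose_spec

noncomputable def octaHom {I J : Mp p} (h : QPair I J) (hp : 2 < p) :
    octa I J →* Equiv.Perm (Fin 4) :=
  MonoidHom.toHomPerm
    { toFun := fun g => octaFun I J g
      map_one' := by
        funext m
        exact mapsD_uniq h hp (octaFun_spec I J 1 m) (mapsD_one m)
      map_mul' := by
        intro g g'
        funext m
        exact mapsD_uniq h hp (octaFun_spec I J (g * g') m)
          (mapsD_mul (octaFun_spec I J g' m) (octaFun_spec I J g _)) }

theorem octaHom_eq {I J : Mp p} (h : QPair I J) (hp : 2 < p) (g : octa I J) {m n : Fin 4}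
    (hm : mapsD I J g.1 m n) : octaHom h hp g m = n :=
  mapsD_uniq h hp (octaFun_spec I J g m) hm

theorem octaHom_iff {I J : Mp p} (h : QPair I J) (hp : 2 < p) (g : octa I J) (m : Fin 4) :
    mapsD I J g.1 m (octaHom h hp g m) := octaFun_spec I J g m

theorem sign_exists {I J : Mp p} {x y z : ZMod p} (hx : x = 1 ∨ x = -1) (hy : y = 1 ∨ y = -1)
    (hz : z = 1 ∨ z = -1) : ∃ n, qv I J x y z = dg I J n ∨ qv I J x y z = - dg I J n := by
  have hneg : ∀ n, - dg I J n = qv I J (-sg1 n) (-sg2 n) (-sg3 n) := by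
    intro n
    simp only [dg, qv]; module
  simp only [hneg]
  rcases hx with rfl | rfl <;> rcases hy with rfl | rfl <;> rcases hz with rfl | rfl
  · exact ⟨0, Or.inl rfl⟩
  · exact ⟨3, Or.inr (by simp [sg1, sg2, sg3])⟩
  · exact ⟨2, Or.inr (by simp [sg1, sg2, sg3])⟩
  · exact ⟨1, Or.inl rfl⟩
  · exact ⟨1, Or.inr (by simp [sg1, sg2, sg3])⟩
  · exact ⟨2, Or.inl rfl⟩
  · exact ⟨3, Or.inl rfl⟩
  · exact ⟨0, Or.inr (by simp [sg1, sg2, sg3])⟩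

theorem pm_mul {x y : ZMod p} (hx : x = 1 ∨ x = -1) (hy : y = 1 ∨ y = -1) :
    x * y = 1 ∨ x * y = -1 := by
  rcases hx with rfl | rfl <;> rcases hy with rfl | rfl <;> simp

theorem pm_neg {x : ZMod p} (hx : x = 1 ∨ x = -1) : -x = 1 ∨ -x = -1 := by
  rcases hx with rfl | rfl <;> simp

theorem sg_pm (m : Fin 4) : (sg1 m = (1 : ZMod p) ∨ sg1 m = (-1 : ZMod p)) ∧
    (sg2 m = (1 : ZMod p) ∨ sg2 m = (-1 : ZMod p)) ∧
    (sg3 m = (1 : ZMod p) ∨ sg3 m = (-1 : ZMod p)) := by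
  fin_cases m <;> simp [sg1, sg2, sg3]

/-- action on the diagonals from action on `I` and `J` -/
theorem act_qv {I J : Mp p} {g : SLp p} {A B : Mp p}
    (hA : (g : Mp p) * I = A * g) (hB : (g : Mp p) * J = B * g) (x y z : ZMod p) :
    (g : Mp p) * qv I J x y z = (x • A + y • B + z • (A * B)) * g := by
  have hAB : (g : Mp p) * (I * J) = A * B * g := by
    rw [← mul_assoc, hA, mul_assoc, hB, mul_assoc]
  simp only [qv, mul_add, add_mul, mul_smul_comm, smul_mul_assoc, hA, hB, hAB]

theorem mem_octa {I J : Mp p} (h : QPair I J) (hp : 2 < p) {g : SLp p} {U V : Mp p} {ε δ : ZMod p}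
    (hε : ε = 1 ∨ ε = -1) (hδ : δ = 1 ∨ δ = -1)
    (hU : U = I ∨ U = J ∨ U = I * J) (hV : V = I ∨ V = J ∨ V = I * J)
    (hA : (g : Mp p) * I = (ε • U) * g) (hB : (g : Mp p) * J = (δ • V) * g) : g ∈ octa I J := by
  have hUV : U ≠ V := by
    rintro rfl
    have hε2 : ε * ε = 1 := by rcases hε with rfl | rfl <;> simp
    have hδ2 : δ * δ = 1 := by rcases hδ with rfl | rfl <;> simp
    have e : (g : Mp p) * qv I J ε (-δ) 0 = 0 := by
      rw [act_qv hA hB]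
      simp only [smul_smul, hε2, neg_mul, hδ2]
      simp
    have e2 : qv I J ε (-δ) 0 = 0 := by
      have h2 : ((g⁻¹ : SLp p) : Mp p) * (g : Mp p) = 1 := by
        rw [← Matrix.SpecialLinearGroup.coe_mul, inv_mul_cancel, Matrix.SpecialLinearGroup.coe_one]
      have := congrArg (fun X => ((g⁻¹ : SLp p) : Mp p) * X) e
      simpa only [← mul_assoc, h2, one_mul, mul_zero] using this
    have := (h.qv_zero hp e2).1
    rw [this] at hε2
    simp at hε2
  intro m
  obtain ⟨s1, s2, s3⟩ := sg_pm (p := p) m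
  have hεδ := pm_mul hε hδ
  suffices hs : ∃ x y z : ZMod p, (x = 1 ∨ x = -1) ∧ (y = 1 ∨ y = -1) ∧ (z = 1 ∨ z = -1) ∧
      (g : Mp p) * dg I J m = qv I J x y z * g by
    obtain ⟨x, y, z, hx, hy, hz, e⟩ := hs
    obtain ⟨n, hn | hn⟩ := sign_exists (I := I) (J := J) hx hy hz
    · exact ⟨n, Or.inl (by rw [e, hn])⟩
    · exact ⟨n, Or.inr (by rw [e, hn, neg_mul])⟩
  rw [dg, act_qv hA hB]
  generalize (sg1 m : ZMod p) = t1 at s1 ⊢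
  generalize (sg2 m : ZMod p) = t2 at s2 ⊢
  generalize (sg3 m : ZMod p) = t3 at s3 ⊢
  have a1 := pm_mul s1 hε
  have a2 := pm_mul s2 hδ
  have a3 := pm_mul s3 hεδ
  have a3' := pm_neg a3
  rcases hU with rfl | rfl | rfl <;> rcases hV with rfl | rfl | rfl
  · exact absurd rfl hUV
  · refine ⟨_, _, _, a1, a2, a3, ?_⟩
    congr 1; simp only [qv, smul_mul_assoc, mul_smul_comm]; module
  · refine ⟨_, _, _, a1, a3', a2, ?_⟩
    congr 1; simp only [qv, smul_mul_assoc, mul_smul_comm, h.IK]; module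
  · refine ⟨_, _, _, a2, a1, a3', ?_⟩
    congr 1; simp only [qv, smul_mul_assoc, mul_smul_comm, h.hJI]; module
  · exact absurd rfl hUV
  · refine ⟨_, _, _, a3, a1, a2, ?_⟩
    congr 1; simp only [qv, smul_mul_assoc, mul_smul_comm, h.JK]; module
  · refine ⟨_, _, _, a2, a3, a1, ?_⟩
    congr 1; simp only [qv, smul_mul_assoc, mul_smul_comm, h.KI]; module
  · refine ⟨_, _, _, a3', a2, a1, ?_⟩
    congr 1; simp only [qv, smul_mul_assoc, mul_smul_comm, h.KJ]; module
  · exact absurd rfl hUV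

end quat


section quat2
variable {p : ℕ} [Fact p.Prime]

/-- elements anticommuting have trace zero -/
theorem anti_trace (hp : 2 < p) {a b : SLp p} (h : b * a = -(a * b)) : a 0 0 + a 1 1 = 0 := by
  have e : a * b = (-b) * a := by rw [neg_mul, h, neg_neg]
  have e2 : b⁻¹ * a * b = -a := by
    have : b⁻¹ * (a * b) = -a := by rw [e]; simp
    rw [mul_assoc, this]
  have h00 : (b⁻¹ * a * b) 0 0 = - a 0 0 := by rw [e2]; rfl
  have h11 : (b⁻¹ * a * b) 1 1 = - a 1 1 := by rw [e2]; rfl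
  simp only [mul_entry, inv00, inv01, inv10, inv11] at h00 h11
  have hd := det_eq b
  have : 2 * (a 0 0 + a 1 1) = 0 := by
    linear_combination h00 + h11 - (a 0 0 + a 1 1) * hd
  simpa [two_ne hp] using this

theorem coe_eq_tz {a : SLp p} (h : a 0 0 + a 1 1 = 0) :
    (a : Mp p) = tz (a 0 0) (a 0 1) (a 1 0) := by
  rw [mat_eq_iff]
  simp [tz]
  linear_combination h

theorem tz_disc {a : SLp p} (h : a 0 0 + a 1 1 = 0) : a 0 0 ^ 2 + a 0 1 * a 1 0 = -1 := by
  linear_combination -det_eq a + a 0 0 * h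

/-- commuting with a trace zero element, and trace zero, gives `±`. -/
theorem comm_pm (hp : 2 < p) {a c : SLp p} (ha : a 0 0 + a 1 1 = 0) (hc : c 0 0 + c 1 1 = 0)
    (h : c * a = a * c) : c = a ∨ c = -a := by
  have hD : a 0 0 ^ 2 + a 0 1 * a 1 0 ≠ 0 := by rw [tz_disc ha]; simp
  have hmem : c ∈ cent (tz (a 0 0) (a 0 1) (a 1 0)) := by
    rw [mem_cent, ← coe_eq_tz ha, ← Matrix.SpecialLinearGroup.coe_mul, h,
      Matrix.SpecialLinearGroup.coe_mul]
  obtain ⟨h1, h2, h3, h4⟩ := comm_form hp _ _ _ hD c hmem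
  have hx : cX c = 0 := by rw [cX, hc, zero_div]
  rw [hx] at h1 h4
  generalize cY (a 0 0) (a 0 1) (a 1 0) c = y at *
  have hy : y * y = 1 := by
    have hd := det_eq c
    rw [h1, h2, h3, h4] at hd
    linear_combination hd + y * y * tz_disc ha
  have ha' : a 1 1 = - a 0 0 := by linear_combination ha
  rcases mul_self_eq_one_iff.1 hy with rfl | rfl
  · left; apply SL_ext
    · rw [h1]; ring
    · rw [h2]; ring
    · rw [h3]; ring
    · rw [h4, ha']; ring
  · right; apply SL_ext <;> rw [neg_entry]
    · rw [h1]; ring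
    · rw [h2]; ring
    · rw [h3]; ring
    · rw [h4, ha']; ring

theorem central_of_comm (hp : 2 < p) {i j g : SLp p} (hij : j * i = -(i * j))
    (h1 : g * i = i * g) (h2 : g * j = j * g) : g ∈ Subgroup.center (SLp p) := by
  have hi := anti_trace hp hij
  have hD : i 0 0 ^ 2 + i 0 1 * i 1 0 ≠ 0 := by rw [tz_disc hi]; simp
  have hmem : g ∈ cent (tz (i 0 0) (i 0 1) (i 1 0)) := by
    rw [mem_cent, ← coe_eq_tz hi, ← Matrix.SpecialLinearGroup.coe_mul, h1,
      Matrix.SpecialLinearGroup.coe_mul]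
  obtain ⟨e1, e2, e3, e4⟩ := comm_form hp _ _ _ hD g hmem
  generalize cY (i 0 0) (i 0 1) (i 1 0) g = y at *
  generalize cX g = x at *
  have hg : (g : Mp p) = x • (1 : Mp p) + y • (i : Mp p) := by
    rw [mat_eq_iff]
    simp
    refine ⟨e1, e2, e3, ?_⟩
    rw [e4]; linear_combination -y * hi
  have h2' : (g : Mp p) * j = j * g := by
    rw [← Matrix.SpecialLinearGroup.coe_mul, h2, Matrix.SpecialLinearGroup.coe_mul]
  have hij' : (j : Mp p) * i = -(i * j) := by
    rw [← Matrix.SpecialLinearGroup.coe_mul, hij]; simp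
  have hy : (2 * y) • ((i * j : SLp p) : Mp p) = 0 := by
    rw [hg] at h2'
    simp only [add_mul, mul_add, smul_mul_assoc, mul_smul_comm, one_mul, mul_one, hij'] at h2'
    rw [Matrix.SpecialLinearGroup.coe_mul]
    have := sub_eq_zero.2 h2'
    rw [← this]
    module
  have hy0 : 2 * y = 0 := by
    rcases smul_eq_zero.1 hy with h | h
    · exact h
    · exfalso
      have hd := det_eq (i * j)
      rw [h] at hd
      simp at hd
  have hy0 : y = 0 := by simpa [two_ne hp] using hy0
  subst hy0
  have hd := det_eq g
  rw [e1, e2, e3, e4] at hd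
  have hx : x * x = 1 := by linear_combination hd
  rw [mem_center_SL]
  rcases mul_self_eq_one_iff.1 hx with rfl | rfl
  · left; apply SL_ext <;> simp [e1, e2, e3, e4]
  · right; apply SL_ext <;> simp [e1, e2, e3, e4]

theorem qpair_of (hp : 2 < p) {i j : SLp p} (hij : j * i = -(i * j)) : QPair (i : Mp p) (j : Mp p) := by
  have hi := anti_trace hp hij
  have hj := anti_trace hp (a := j) (b := i) (by rw [hij, neg_neg])
  refine ⟨?_, ?_, ?_⟩
  · rw [← Matrix.SpecialLinearGroup.coe_mul, tr0_sq hi]; simp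
  · rw [← Matrix.SpecialLinearGroup.coe_mul, tr0_sq hj]; simp
  · rw [← Matrix.SpecialLinearGroup.coe_mul, hij]; simp

theorem dg_ne {I J : Mp p} (h : QPair I J) (hp : 2 < p) (m : Fin 4) : dg I J m ≠ 0 := by
  intro e
  have := (h.qv_zero hp e).1
  rcases (sg_pm (p := p) m).1 with h | h <;> rw [h] at this <;> simp at this

theorem octa_ker (hp : 2 < p) {i j : SLp p} (hij : j * i = -(i * j)) :
    (octaHom (qpair_of hp hij) hp).ker =
      (Subgroup.center (SLp p)).subgroupOf (octa (i : Mp p) (j : Mp p)) := by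
  have h := qpair_of hp hij
  ext ⟨g, hg⟩
  rw [MonoidHom.mem_ker, Subgroup.mem_subgroupOf]
  constructor
  · intro hk
    have hm : ∀ m, ∃ ε : ZMod p, (ε = 1 ∨ ε = -1) ∧
        (g : Mp p) * dg (i : Mp p) j m = (ε • dg (i : Mp p) j m) * g := by
      intro m
      have := octaHom_iff h hp ⟨g, hg⟩ m
      rw [hk] at this
      rcases this with e | e
      · exact ⟨1, Or.inl rfl, by rw [one_smul]; exact e⟩
      · exact ⟨-1, Or.inr rfl, by rw [neg_smul, one_smul, neg_mul]; exact e⟩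
    choose ε hε he using hm
    have hsum : qv (i : Mp p) j (ε 0 + ε 1 - ε 2 - ε 3) (ε 0 - ε 1 + ε 2 - ε 3)
        (ε 0 - ε 1 - ε 2 + ε 3) = 0 := by
      apply SL_cancel (g := g)
      have e0 := he 0
      have e1 := he 1
      have e2 := he 2
      have e3 := he 3
      have : (g : Mp p) * (dg (i : Mp p) j 0 + dg (i : Mp p) j 1 + dg (i : Mp p) j 2 +
          dg (i : Mp p) j 3) = 0 := by
        have : dg (i : Mp p) j 0 + dg (i : Mp p) j 1 + dg (i : Mp p) j 2 +
          dg (i : Mp p) j 3 = 0 := by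
          simp [dg, qv, sg1, sg2, sg3]; module
        rw [this, mul_zero]
      rw [mul_add, mul_add, mul_add, e0, e1, e2, e3] at this
      rw [zero_mul, ← this, ← add_mul, ← add_mul, ← add_mul]
      congr 1
      simp [dg, qv, sg1, sg2, sg3]; module
    obtain ⟨k1, k2, k3⟩ := h.qv_zero hp hsum
    have h2 := two_ne hp
    have q1 : ε 1 = ε 0 := by
      apply mul_left_cancel₀ h2; linear_combination -k2 - k3
    have q2 : ε 2 = ε 0 := by
      apply mul_left_cancel₀ h2; linear_combination -k1 - k3
    have q3 : ε 3 = ε 0 := by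
      apply mul_left_cancel₀ h2; linear_combination -k1 - k2
    have f0 := he 0
    have f1 := he 1
    have f2 := he 2
    have f3 := he 3
    rw [q1] at f1
    rw [q2] at f2
    rw [q3] at f3
    have hε0 := hε 0
    generalize ε 0 = t at *
    have inv2 : ∀ X Y : Mp p, (2 : ZMod p) • X = (2 : ZMod p) • Y → X = Y := fun X Y hXY =>
      smul_right_injective _ h2 hXY
    have hI : (g : Mp p) * i = (t • (i : Mp p)) * g := by
      apply inv2
      have c : (2 : ZMod p) • (i : Mp p) = dg (i : Mp p) j 0 + dg (i : Mp p) j 1 := by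
        simp [dg, qv, sg1, sg2, sg3]; module
      rw [← mul_smul_comm, ← smul_mul_assoc, smul_comm (2 : ZMod p) t, c, mul_add, f0, f1, smul_add,
        add_mul]
    have hJ : (g : Mp p) * j = (t • (j : Mp p)) * g := by
      apply inv2
      have c : (2 : ZMod p) • (j : Mp p) = dg (i : Mp p) j 0 + dg (i : Mp p) j 2 := by
        simp [dg, qv, sg1, sg2, sg3]; module
      rw [← mul_smul_comm, ← smul_mul_assoc, smul_comm (2 : ZMod p) t, c, mul_add, f0, f2, smul_add,
        add_mul]
    have hK : (g : Mp p) * ((i : Mp p) * j) = (t • ((i : Mp p) * j)) * g := by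
      apply inv2
      have c : (2 : ZMod p) • ((i : Mp p) * j) = dg (i : Mp p) j 0 + dg (i : Mp p) j 3 := by
        simp [dg, qv, sg1, sg2, sg3]; module
      rw [← mul_smul_comm (2 : ZMod p) (g : Mp p) ((i : Mp p) * j),
        ← smul_mul_assoc (2 : ZMod p) (t • ((i : Mp p) * j)) (g : Mp p),
        smul_comm (2 : ZMod p) t, c, mul_add, f0, f3, smul_add, add_mul]
    have ht : t = 1 := by
      have hK2 := act_qv hI hJ 0 0 1
      simp only [qv, zero_smul, one_smul, zero_add] at hK2
      rw [hK] at hK2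
      have e := SL_cancel hK2
      have e2 : qv (i : Mp p) j 0 0 (t - t * t) = 0 := by
        rw [← sub_eq_zero] at e
        rw [← e]
        simp only [qv, smul_mul_assoc, mul_smul_comm]; module
      have e3 := (h.qv_zero hp e2).2.2
      rcases hε0 with rfl | rfl
      · rfl
      · exfalso; apply h2; linear_combination -e3
    subst ht
    rw [one_smul] at hI hJ
    apply central_of_comm hp hij
    · apply Subtype.ext; exact hI
    · apply Subtype.ext; exact hJ
  · intro hc
    ext m : 1
    rw [Equiv.Perm.one_apply]
    apply octaHom_eq
    have := Subgroup.mem_center_iff.1 hc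
    rcases mem_center_SL.1 hc with h | h
    · change g = 1 at h
      subst h; exact mapsD_one m
    · change g = -1 at h
      subst h; left; simp

end quat2


section quat3
variable {p : ℕ} [Fact p.Prime]

theorem exists_omega (hp : 2 < p) {i j : SLp p} (hij : j * i = -(i * j)) :
    ∃ w : SLp p, (w : Mp p) * i = j * w ∧ (w : Mp p) * j = ((i : Mp p) * j) * w := by
  have h := qpair_of hp hij
  have hi := anti_trace hp hij
  have hj := anti_trace hp (a := j) (b := i) (by rw [hij, neg_neg])
  have h2 := two_ne hp
  have hk : (i * j) 0 0 + (i * j) 1 1 = 0 := by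
    apply anti_trace hp (b := j)
    rw [← mul_assoc, hij, neg_mul]
  set X : Mp p := qv (i : Mp p) j 1 1 1 with hX
  have hXX : X * X = (-3 : ZMod p) • (1 : Mp p) := by
    rw [hX]
    simp only [qv, one_smul, mul_add, add_mul, h.hI, h.hJ, h.hJI, h.IK, h.KI, h.JK, h.KJ, h.KK]
    module
  have htr : X 0 0 + X 1 1 = 0 := by
    have e : ∀ a : Fin 2, X a a = i a a + j a a + (i * j) a a := by
      intro a
      rw [hX]; simp [qv]
    rw [e, e]; linear_combination hi + hj + hk
  have h00 : X 0 0 * X 0 0 + X 0 1 * X 1 0 = -3 := by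
    have := congrFun (congrFun hXX 0) 0
    simpa [Matrix.mul_apply, Fin.sum_univ_two] using this
  let w : SLp p := mkSL ((1 + X 0 0) / 2) (X 0 1 / 2) (X 1 0 / 2) ((1 - X 0 0) / 2) (by
    field_simp; linear_combination -h00)
  have hw : (w : Mp p) = (2⁻¹ : ZMod p) • (1 + X) := by
    rw [mat_eq_iff]
    simp [w, mkSL, div_eq_inv_mul]
    left; linear_combination -htr
  refine ⟨w, ?_, ?_⟩
  · rw [hw, smul_mul_assoc, mul_smul_comm, hX]
    congr 1
    simp only [qv, one_smul, mul_add, add_mul, h.hI, h.hJ, h.hJI, h.IK, h.KI, h.JK, h.KJ, h.KK,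
      one_mul, mul_one]
    module
  · rw [hw, smul_mul_assoc, mul_smul_comm, hX]
    congr 1
    simp only [qv, one_smul, mul_add, add_mul, h.hI, h.hJ, h.hJI, h.IK, h.KI, h.JK, h.KJ, h.KK,
      one_mul, mul_one]
    module

theorem alt_gen : ∀ σ : Equiv.Perm (Fin 4), Equiv.Perm.sign σ = 1 → ∃ a b : Fin 2, ∃ c : Fin 3,
    ∀ s t u : Equiv.Perm (Fin 4), s = Equiv.swap 0 1 * Equiv.swap 2 3 →
     t = Equiv.swap 0 2 * Equiv.swap 1 3 → u = Equiv.swap 1 2 * Equiv.swap 2 3 →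
    σ = s ^ (a : ℕ) * t ^ (b : ℕ) * u ^ (c : ℕ) := by
  suffices ∀ σ : Equiv.Perm (Fin 4), Equiv.Perm.sign σ = 1 → ∃ a b : Fin 2, ∃ c : Fin 3,
      σ = (Equiv.swap 0 1 * Equiv.swap 2 3) ^ (a : ℕ) * (Equiv.swap 0 2 * Equiv.swap 1 3) ^ (b : ℕ) *
        (Equiv.swap 1 2 * Equiv.swap 2 3) ^ (c : ℕ) by
    intro σ hσ
    obtain ⟨a, b, c, h⟩ := this σ hσ
    refine ⟨a, b, c, ?_⟩
    rintro _ _ _ rfl rfl rfl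
    exact h
  decide +kernel

theorem octa_alt (hp : 2 < p) {i j : SLp p} (hij : j * i = -(i * j)) :
    alternatingGroup (Fin 4) ≤ (octaHom (qpair_of hp hij) hp).range := by
  have h := qpair_of hp hij
  obtain ⟨w, hw1, hw2⟩ := exists_omega hp hij
  have hi1 : (i : Mp p) * i = ((1 : ZMod p) • (i : Mp p)) * i := by rw [one_smul]
  have hi2 : (i : Mp p) * j = ((-1 : ZMod p) • (j : Mp p)) * i := by
    rw [neg_smul, one_smul, neg_mul, h.hJI, neg_neg]
  have hj1 : (j : Mp p) * i = ((-1 : ZMod p) • (i : Mp p)) * j := by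
    rw [neg_smul, one_smul, neg_mul, h.hJI]
  have hj2 : (j : Mp p) * j = ((1 : ZMod p) • (j : Mp p)) * j := by rw [one_smul]
  have mi : i ∈ octa (i : Mp p) j :=
    mem_octa h hp (Or.inl rfl) (Or.inr rfl) (Or.inl rfl) (Or.inr (Or.inl rfl)) hi1 hi2
  have mj : j ∈ octa (i : Mp p) j :=
    mem_octa h hp (Or.inr rfl) (Or.inl rfl) (Or.inl rfl) (Or.inr (Or.inl rfl)) hj1 hj2
  have mw : w ∈ octa (i : Mp p) j :=
    mem_octa h hp (ε := 1) (δ := 1) (Or.inl rfl) (Or.inl rfl) (Or.inr (Or.inl rfl)) (Or.inr (Or.inr rfl))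
      (by rw [one_smul]; exact hw1) (by rw [one_smul]; exact hw2)
  have ei : octaHom h hp ⟨i, mi⟩ = Equiv.swap 0 1 * Equiv.swap 2 3 := by
    ext m : 1
    have tab : ∀ m : Fin 4, (Equiv.swap 0 1 * Equiv.swap 2 3 : Equiv.Perm (Fin 4)) m = (![1, 0, 3, 2] : Fin 4 → Fin 4) m := by decide
    rw [tab]
    apply octaHom_eq
    unfold mapsD
    have e := act_qv hi1 hi2 (sg1 m) (sg2 m) (sg3 m)
    rw [dg, e, ← neg_mul]
    fin_cases m
    · left; congr 1
      simp [dg, qv, sg1, sg2, sg3]; first | done | module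
    · left; congr 1
      simp [dg, qv, sg1, sg2, sg3]; first | done | module
    · left; congr 1
      simp [dg, qv, sg1, sg2, sg3]; first | done | module
    · left; congr 1
      simp [dg, qv, sg1, sg2, sg3]; first | done | module
  have ej : octaHom h hp ⟨j, mj⟩ = Equiv.swap 0 2 * Equiv.swap 1 3 := by
    ext m : 1
    have tab : ∀ m : Fin 4, (Equiv.swap 0 2 * Equiv.swap 1 3 : Equiv.Perm (Fin 4)) m = (![2, 3, 0, 1] : Fin 4 → Fin 4) m := by decide
    rw [tab]
    apply octaHom_eq
    unfold mapsD
    have e := act_qv hj1 hj2 (sg1 m) (sg2 m) (sg3 m)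
    rw [dg, e, ← neg_mul]
    fin_cases m
    · left; congr 1
      simp [dg, qv, sg1, sg2, sg3]; first | done | module
    · left; congr 1
      simp [dg, qv, sg1, sg2, sg3]; first | done | module
    · left; congr 1
      simp [dg, qv, sg1, sg2, sg3]; first | done | module
    · left; congr 1
      simp [dg, qv, sg1, sg2, sg3]; first | done | module
  have ew : octaHom h hp ⟨w, mw⟩ = Equiv.swap 1 2 * Equiv.swap 2 3 := by
    ext m : 1
    have tab : ∀ m : Fin 4, (Equiv.swap 1 2 * Equiv.swap 2 3 : Equiv.Perm (Fin 4)) m = (![0, 2, 3, 1] : Fin 4 → Fin 4) m := by decide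
    rw [tab]
    apply octaHom_eq
    unfold mapsD
    have e := act_qv hw1 hw2 (sg1 m) (sg2 m) (sg3 m)
    rw [dg, e, ← neg_mul, h.JK]
    fin_cases m
    · left; congr 1
      simp [dg, qv, sg1, sg2, sg3]; module
    · left; congr 1
      simp [dg, qv, sg1, sg2, sg3]; module
    · left; congr 1
      simp [dg, qv, sg1, sg2, sg3]; module
    · left; congr 1
      simp [dg, qv, sg1, sg2, sg3]; module
  intro σ hσ
  obtain ⟨a, b, c, hs⟩ := alt_gen σ (Equiv.Perm.mem_alternatingGroup.1 hσ)
  rw [hs _ _ _ ei ej ew]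
  refine mul_mem (mul_mem (pow_mem ?_ _) (pow_mem ?_ _)) (pow_mem ?_ _) <;> exact ⟨_, rfl⟩

theorem octa_iso (hp : 2 < p) {i j : SLp p} (hij : j * i = -(i * j)) :
    Nonempty (↥((octa (i : Mp p) j).map (mkP p)) ≃* alternatingGroup (Fin 4)) ∨
    Nonempty (↥((octa (i : Mp p) j).map (mkP p)) ≃* Equiv.Perm (Fin 4)) := by
  have h := qpair_of hp hij
  obtain ⟨e⟩ := mulEquiv_of_ker_eq ((mkP p).subgroupMap (octa (i : Mp p) j))
    (octaHom h hp).rangeRestrict ((mkP p).subgroupMap_surjective _)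
    (octaHom h hp).rangeRestrict_surjective (by
      rw [MonoidHom.ker_rangeRestrict, octa_ker hp hij, Subgroup.ker_subgroupMap]
      congr 1
      exact QuotientGroup.ker_mk' _)
  have hle := octa_alt hp hij
  have hdvd := Subgroup.index_dvd_of_le hle
  rw [alternatingGroup.index_eq_two] at hdvd
  rcases (Nat.dvd_prime Nat.prime_two).1 hdvd with h1 | h1
  · right
    rw [Subgroup.index_eq_one] at h1
    exact ⟨e.trans ((MulEquiv.subgroupCongr h1).trans Subgroup.topEquiv)⟩
  · left
    have := Equiv.Perm.eq_alternatingGroup_of_index_eq_two h1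
    exact ⟨e.trans (MulEquiv.subgroupCongr this)⟩

end quat3


section main
variable {p : ℕ} [Fact p.Prime]

/-- The list of allowed isomorphism types. -/
def GoodK (K : Subgroup (SLp p ⧸ Subgroup.center (SLp p))) : Prop :=
  (∃ φ : Multiplicative (ZMod ((p - 1) / 2)) →* MulAut (Multiplicative (ZMod p)),
          Nonempty (↥K ≃* SemidirectProduct (Multiplicative (ZMod p))
            (Multiplicative (ZMod ((p - 1) / 2))) φ)) ∨
       Nonempty (↥K ≃* alternatingGroup (Fin 4)) ∨
       Nonempty (↥K ≃* Equiv.Perm (Fin 4)) ∨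
       Nonempty (↥K ≃* DihedralGroup ((p - 1) / 2)) ∨
       Nonempty (↥K ≃* DihedralGroup ((p + 1) / 2))

theorem p_odd (hp : 2 < p) : p % 2 = 1 :=
  Nat.odd_iff.1 ((Fact.out : p.Prime).odd_of_ne_two (by omega))

theorem good_dcent (hp : 2 < p) (α β γ : ZMod p) (hD : α ^ 2 + β * γ ≠ 0) :
    GoodK ((dcent (tz α β γ)).map (mkP p)) := by
  have ho := p_odd hp
  by_cases hs : IsSquare (α ^ 2 + β * γ)
  · obtain ⟨s, hs⟩ := hs
    have hs0 : s ≠ 0 := by rintro rfl; apply hD; rw [hs, mul_zero]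
    have hc := conic_card_split hp s hs0
    rw [sq s, ← hs] at hc
    exact Or.inr (Or.inr (Or.inr (Or.inl (dcent_iso hp α β γ hD _ (by rw [hc]; omega)))))
  · have hc := conic_card_nonsplit hp _ hs
    exact Or.inr (Or.inr (Or.inr (Or.inr (dcent_iso hp α β γ hD _ (by rw [hc]; omega)))))

theorem good_borel (hp : 2 < p) : GoodK ((borelS p).map (mkP p)) := Or.inl (borel_iso hp)

theorem good_iso {K L : Subgroup (SLp p ⧸ Subgroup.center (SLp p))} (e : L ≃* K) (h : GoodK K) :
    GoodK L := by
  rcases h with ⟨φ, ⟨f⟩⟩ | ⟨⟨f⟩⟩ | ⟨⟨f⟩⟩ | ⟨⟨f⟩⟩ | ⟨⟨f⟩⟩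
  · exact Or.inl ⟨φ, ⟨e.trans f⟩⟩
  · exact Or.inr (Or.inl ⟨e.trans f⟩)
  · exact Or.inr (Or.inr (Or.inl ⟨e.trans f⟩))
  · exact Or.inr (Or.inr (Or.inr (Or.inl ⟨e.trans f⟩)))
  · exact Or.inr (Or.inr (Or.inr (Or.inr ⟨e.trans f⟩)))

theorem good_conj_borel (hp : 2 < p) (x : SLp p) :
    GoodK ((((borelS p).map (mkP p))).comap (MulAut.conj (mkP p x)).toMonoidHom) := by
  apply good_iso _ (good_borel hp)
  exact (MulEquiv.subgroupCongr (Subgroup.comap_equiv_eq_map_symm' _ _)).trans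
    ((((borelS p).map (mkP p)).equivMapOfInjective _
      (MulAut.conj (mkP p x)).symm.injective).symm)

theorem stab_good (hp : 2 < p) (α β γ : ZMod p) (h0 : ¬ (α = 0 ∧ β = 0 ∧ γ = 0))
    (H : Subgroup (SLp p ⧸ Subgroup.center (SLp p)))
    (hH : ∀ h : SLp p, mkP p h ∈ H → ∃ c : ZMod p, (h : Mp p) * tz α β γ = c • (tz α β γ * h)) :
    ∃ K, H ≤ K ∧ GoodK K := by
  have hsurj : Function.Surjective (mkP p) := QuotientGroup.mk'_surjective _
  by_cases hD : α ^ 2 + β * γ = 0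
  · by_cases hγ : γ = 0
    · have hα : α = 0 := by simpa [hγ] using hD
      have hβ : β ≠ 0 := fun hβ => h0 ⟨hα, hβ, hγ⟩
      refine ⟨_, ?_, good_borel hp⟩
      intro y hy
      obtain ⟨h, rfl⟩ := hsurj y
      obtain ⟨c, hc⟩ := hH h hy
      refine ⟨h, mem_borel.2 ?_, rfl⟩
      have e11 := congrFun (congrFun hc 1) 1
      simp only [tz, Matrix.smul_apply, smul_eq_mul, Matrix.mul_apply, Fin.sum_univ_two, Matrix.of_apply,
        Matrix.cons_val', Matrix.cons_val_zero, Matrix.cons_val_one, Matrix.cons_val_fin_one] at e11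
      rw [hα, hγ] at e11
      have : h 1 0 * β = 0 := by linear_combination e11
      exact (mul_eq_zero.1 this).resolve_right hβ
    · let x : SLp p := mkSL 0 (1 / γ) (-γ) α (by field_simp; ring)
      refine ⟨_, ?_, good_conj_borel hp x⟩
      intro y hy
      obtain ⟨h, rfl⟩ := hsurj y
      obtain ⟨c, hc⟩ := hH h hy
      refine ⟨x * h * x⁻¹, mem_borel.2 ?_, by simp⟩
      have e10 := congrFun (congrFun hc 1) 0
      have e00 := congrFun (congrFun hc 0) 0
      have e11 := congrFun (congrFun hc 1) 1
      simp only [tz, Matrix.smul_apply, smul_eq_mul, Matrix.mul_apply, Fin.sum_univ_two, Matrix.of_apply,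
        Matrix.cons_val', Matrix.cons_val_zero, Matrix.cons_val_one, Matrix.cons_val_fin_one] at e00 e10 e11
      have hd := det_eq h
      have hc0 : c ≠ 0 := by
        rintro rfl
        apply hγ
        linear_combination h 0 0 * e10 - h 1 0 * e00 - γ * hd
      have q : c * ((-γ * h 0 0 + α * h 1 0) * α + (-γ * h 0 1 + α * h 1 1) * γ) = 0 := by
        linear_combination α * e10 + γ * e11 - h 1 0 * hD
      have q := (mul_eq_zero.1 q).resolve_left hc0
      simp only [mul_entry, inv00, inv10]
      simp [x, mkSL]
      linear_combination q
  · refine ⟨_, ?_, good_dcent hp α β γ hD⟩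
    intro y hy
    obtain ⟨h, rfl⟩ := hsurj y
    obtain ⟨c, hc⟩ := hH h hy
    refine ⟨h, ?_, rfl⟩
    have hdet := congrArg Matrix.det hc
    rw [Matrix.det_smul, Matrix.det_mul, Matrix.det_mul, h.2] at hdet
    have hdt : (tz α β γ).det = -(α ^ 2 + β * γ) := by
      rw [tz, Matrix.det_fin_two_of]; ring
    rw [hdt] at hdet
    have hc2 : c * c = 1 := by
      have : (α ^ 2 + β * γ) * (c * c) = (α ^ 2 + β * γ) * 1 := by
        simp at hdet
        linear_combination hdet
      exact mul_left_cancel₀ hD this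
    refine mem_dcent.2 ?_
    rcases mul_self_eq_one_iff.1 hc2 with rfl | rfl
    · left; rw [hc, one_smul]
    · right; rw [hc, neg_smul, one_smul]

end main


theorem exists_abelian_normal {H : Type*} [Group H] [Group.IsSolvable H] [Nontrivial H] :
    ∃ A : Subgroup H, A ≠ ⊥ ∧ A.Normal ∧ ∀ a ∈ A, ∀ b ∈ A, a * b = b * a := by
  classical
  have hs : ∃ n, derivedSeries H n = ⊥ := Group.IsSolvable.solvable
  have hmin : ∀ m, m < Nat.find hs → derivedSeries H m ≠ ⊥ := fun m hm => Nat.find_min hs hm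
  have hspec := Nat.find_spec hs
  cases hn : Nat.find hs with
  | zero =>
    rw [hn, derivedSeries_zero] at hspec
    exact absurd hspec top_ne_bot
  | succ k =>
    rw [hn, derivedSeries_succ, Subgroup.commutator_eq_bot_iff_le_centralizer] at hspec
    refine ⟨derivedSeries H k, hmin _ (by omega), inferInstance, ?_⟩
    intro a ha b hb
    exact Subgroup.mem_centralizer_iff.1 (hspec hb) a ha

section main2
variable {p : ℕ} [Fact p.Prime]

/-- two commuting matrices of trace zero, one nonzero, are proportional -/
theorem tz_prop (hp : 2 < p) {α β γ x y z : ZMod p} (h0 : ¬ (α = 0 ∧ β = 0 ∧ γ = 0))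
    (h : tz x y z * tz α β γ = tz α β γ * tz x y z) : ∃ c : ZMod p, tz x y z = c • tz α β γ := by
  obtain ⟨h1, h2, h3⟩ := (comm_iff α β γ (tz x y z)).1 h
  simp [tz] at h1 h2 h3
  have t2 := two_ne hp
  have h2' : β * x = α * y := mul_left_cancel₀ t2 (by linear_combination h2)
  have h3' : γ * x = α * z := mul_left_cancel₀ t2 (by linear_combination h3)
  have fin : ∀ c, x = c * α → y = c * β → z = c * γ → ∃ c : ZMod p, tz x y z = c • tz α β γ := by
    rintro c rfl rfl rfl
    exact ⟨c, by rw [mat_eq_iff]; simp [tz]⟩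
  by_cases ha : α = 0
  · by_cases hb : β = 0
    · have hc : γ ≠ 0 := fun hc => h0 ⟨ha, hb, hc⟩
      apply fin (z / γ) <;> field_simp
      · linear_combination h3'
      · linear_combination h1
    · apply fin (y / β) <;> field_simp
      · linear_combination h2'
      · linear_combination -h1
  · apply fin (x / α) <;> field_simp
    · linear_combination -h2'
    · linear_combination -h3'

theorem coe_mul_inv (h : SLp p) : (h : Mp p) * ((h⁻¹ : SLp p) : Mp p) = 1 := by
  rw [← Matrix.SpecialLinearGroup.coe_mul, mul_inv_cancel, Matrix.SpecialLinearGroup.coe_one]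

theorem coe_inv_mul (h : SLp p) : ((h⁻¹ : SLp p) : Mp p) * (h : Mp p) = 1 := by
  rw [← Matrix.SpecialLinearGroup.coe_mul, inv_mul_cancel, Matrix.SpecialLinearGroup.coe_one]

theorem eq_tz_of_trace {M : Mp p} (h : M 0 0 + M 1 1 = 0) : M = tz (M 0 0) (M 0 1) (M 1 0) := by
  rw [mat_eq_iff]
  simp [tz]
  linear_combination h

theorem case_one (hp : 2 < p) (H : Subgroup (SLp p ⧸ Subgroup.center (SLp p)))
    (a : SLp p) (ha : a ∉ Subgroup.center (SLp p))
    (hH : ∀ h : SLp p, mkP p h ∈ H → (h * a * h⁻¹) * a = a * (h * a * h⁻¹)) :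
    ∃ K, H ≤ K ∧ GoodK K := by
  have t2 := two_ne hp
  set α := (a 0 0 - a 1 1) / 2 with hα
  have h0 : ¬ (α = 0 ∧ a 0 1 = 0 ∧ a 1 0 = 0) := by
    rintro ⟨e1, e2, e3⟩
    apply ha
    have e : a 0 0 = a 1 1 := by
      rw [hα, div_eq_zero_iff] at e1
      exact sub_eq_zero.1 (e1.resolve_right t2)
    have hd := det_eq a
    rw [e, e2, e3] at hd
    have hx : a 1 1 * a 1 1 = 1 := by linear_combination hd
    rw [mem_center_SL]
    rcases mul_self_eq_one_iff.1 hx with h | h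
    · left; apply SL_ext <;> simp [e, e2, e3, h]
    · right; apply SL_ext <;> simp [e, e2, e3, h]
  apply stab_good hp α (a 0 1) (a 1 0) h0
  intro h hh
  have hcom := hH h hh
  set N := tz α (a 0 1) (a 1 0) with hN
  set t := (a 0 0 + a 1 1) / 2 with ht
  have haN : (a : Mp p) = N + t • 1 := by
    rw [mat_eq_iff]
    simp [hN, tz, hα, ht]
    constructor <;> field_simp <;> ring
  set M : Mp p := (h : Mp p) * N * ((h⁻¹ : SLp p) : Mp p) with hM
  have hconj : ((h * a * h⁻¹ : SLp p) : Mp p) = M + t • 1 := by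
    rw [Matrix.SpecialLinearGroup.coe_mul, Matrix.SpecialLinearGroup.coe_mul, haN, mul_add, add_mul,
      mul_smul_comm, mul_one, smul_mul_assoc, coe_mul_inv]
  have hMN : M * N = N * M := by
    have := congrArg (fun g : SLp p => (g : Mp p)) hcom
    simp only [Matrix.SpecialLinearGroup.coe_mul (h * a * h⁻¹),
      Matrix.SpecialLinearGroup.coe_mul a, hconj] at this
    rw [haN] at this
    simp only [mul_add, add_mul, mul_smul_comm, smul_mul_assoc, mul_one, one_mul] at this
    have e := sub_eq_zero.2 this
    rw [← sub_eq_zero, ← e]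
    module
  have htr : M 0 0 + M 1 1 = 0 := by
    have : M.trace = 0 := by
      rw [hM, mul_assoc, Matrix.trace_mul_comm, mul_assoc, coe_inv_mul, mul_one, Matrix.trace_fin_two, hN]
      simp [tz]
    rwa [Matrix.trace_fin_two] at this
  have hMt := eq_tz_of_trace htr
  rw [hMt, hN] at hMN
  obtain ⟨c, hc⟩ := tz_prop hp h0 hMN
  rw [← hMt, ← hN] at hc
  refine ⟨c, ?_⟩
  rw [← smul_mul_assoc, ← hc, hM, mul_assoc, coe_inv_mul, mul_one]

theorem case_two (hp : 2 < p) (H : Subgroup (SLp p ⧸ Subgroup.center (SLp p)))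
    (P : SLp p → Prop) (hcomm : ∀ a b, P a → P b → b * a = a * b ∨ b * a = -(a * b))
    (hconj : ∀ a h, P a → mkP p h ∈ H → P (h * a * h⁻¹))
    (a b : SLp p) (ha : P a) (hb : P b) (hab : b * a = -(a * b)) :
    ∃ K, H ≤ K ∧ GoodK K := by
  have hq := qpair_of hp hab
  have hta := anti_trace hp hab
  have htb := anti_trace hp (a := b) (b := a) (by rw [hab, neg_neg])
  have htk : (a * b) 0 0 + (a * b) 1 1 = 0 := by
    apply anti_trace hp (b := b)
    rw [← mul_assoc, hab, neg_mul]
  have key : ∀ c, P c → c 0 0 + c 1 1 = 0 → ∃ (ε : ZMod p) (U : Mp p), (ε = 1 ∨ ε = -1) ∧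
      (U = a ∨ U = b ∨ U = (a : Mp p) * b) ∧ (c : Mp p) = ε • U := by
    intro c hc htc
    have fin : ∀ d : SLp p, (c = d ∨ c = -d) → ∃ ε : ZMod p, (ε = 1 ∨ ε = -1) ∧
        (c : Mp p) = ε • (d : Mp p) := by
      rintro d (rfl | rfl)
      · exact ⟨1, Or.inl rfl, by rw [one_smul]⟩
      · exact ⟨-1, Or.inr rfl, by simp⟩
    rcases hcomm a c ha hc with h1 | h1
    · obtain ⟨ε, h, h'⟩ := fin a (comm_pm hp hta htc h1)
      exact ⟨ε, _, h, Or.inl rfl, h'⟩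
    rcases hcomm b c hb hc with h2 | h2
    · obtain ⟨ε, h, h'⟩ := fin b (comm_pm hp htb htc h2)
      exact ⟨ε, _, h, Or.inr (Or.inl rfl), h'⟩
    · obtain ⟨ε, h, h'⟩ := fin (a * b) (comm_pm hp htk htc (by
        rw [← mul_assoc, h1, neg_mul, mul_assoc, h2, mul_neg, neg_neg, mul_assoc]))
      exact ⟨ε, _, h, Or.inr (Or.inr rfl), by rw [h', Matrix.SpecialLinearGroup.coe_mul]⟩
  have trc : ∀ x h : SLp p, x 0 0 + x 1 1 = 0 → (h * x * h⁻¹) 0 0 + (h * x * h⁻¹) 1 1 = 0 := by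
    intro x h hx
    simp only [mul_entry, inv00, inv01, inv10, inv11]
    linear_combination (h 0 0 * h 1 1 - h 0 1 * h 1 0) * hx
  refine ⟨(octa (a : Mp p) b).map (mkP p), ?_, ?_⟩
  · intro y hy
    obtain ⟨h, rfl⟩ := QuotientGroup.mk'_surjective _ y
    refine ⟨h, ?_, rfl⟩
    obtain ⟨ε, U, hε, hU, hA⟩ := key _ (hconj a h ha hy) (trc a h hta)
    obtain ⟨δ, V, hδ, hV, hB⟩ := key _ (hconj b h hb hy) (trc b h htb)
    refine mem_octa hq hp hε hδ hU hV ?_ ?_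
    · rw [← hA, ← Matrix.SpecialLinearGroup.coe_mul, ← Matrix.SpecialLinearGroup.coe_mul]; simp
    · rw [← hB, ← Matrix.SpecialLinearGroup.coe_mul, ← Matrix.SpecialLinearGroup.coe_mul]; simp
  · rcases octa_iso hp hab with h | h
    · exact Or.inr (Or.inl h)
    · exact Or.inr (Or.inr (Or.inl h))

theorem main_good (hp : 2 < p) (H : Subgroup (SLp p ⧸ Subgroup.center (SLp p)))
    (hH : Group.IsSolvable H) : ∃ K, H ≤ K ∧ GoodK K := by
  rcases subsingleton_or_nontrivial H with hs | hs
  · refine ⟨_, ?_, good_borel hp⟩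
    rw [Subgroup.eq_bot_of_subsingleton H]
    exact bot_le
  obtain ⟨A, hA, hAn, hAc⟩ := exists_abelian_normal (H := H)
  let P : SLp p → Prop := fun a => ∃ x ∈ A, (x : SLp p ⧸ Subgroup.center (SLp p)) = mkP p a
  have hcomm : ∀ a b, P a → P b → b * a = a * b ∨ b * a = -(a * b) := by
    rintro a b ⟨x, hx, ex⟩ ⟨y, hy, ey⟩
    apply mkP_eq
    rw [map_mul, map_mul, ← ex, ← ey]
    exact congrArg Subtype.val (hAc x hx y hy)
  have hconj : ∀ a h, P a → mkP p h ∈ H → P (h * a * h⁻¹) := by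
    rintro a h ⟨x, hx, ex⟩ hh
    refine ⟨⟨mkP p h, hh⟩ * x * ⟨mkP p h, hh⟩⁻¹, hAn.conj_mem x hx _, ?_⟩
    rw [map_mul, map_mul, ← ex, map_inv]
    rfl
  obtain ⟨⟨x, hx⟩, hx0⟩ := Subgroup.ne_bot_iff_exists_ne_one.1 hA
  have hx1 : x ≠ 1 := fun e => hx0 (Subtype.ext e)
  obtain ⟨a, ea⟩ := QuotientGroup.mk'_surjective _ (x : SLp p ⧸ Subgroup.center (SLp p))
  have hPa : P a := ⟨x, hx, ea.symm⟩
  have ha : a ∉ Subgroup.center (SLp p) := by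
    intro hc
    apply hx1
    apply Subtype.ext
    rw [← ea]
    exact (QuotientGroup.eq_one_iff a).2 hc
  by_cases hall : ∀ b, P b → b * a = a * b
  · exact case_one hp H a ha (fun h hh => hall _ (hconj a h hPa hh))
  · push Not at hall
    obtain ⟨b, hPb, hb⟩ := hall
    exact case_two hp H P hcomm hconj a b hPa hPb ((hcomm a b hPa hPb).resolve_left hb)

end main2

/-- Let `p > 7` be a prime and `G = PSL(2, p)`. Every solvable subgroup of `G` is
contained in a subgroup isomorphic to one of: a semidirect product
`ℤ/pℤ ⋊ ℤ/((p−1)/2)ℤ` of a cyclic group of order `p` by a cyclic group of order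
`(p−1)/2`; the alternating group `A₄`; the symmetric group `S₄`; the dihedral group
of order `p−1`; or the dihedral group of order `p+1`. -/
theorem solvable_subgroup_PSL_two_p (p : ℕ) (hp : p.Prime) (hp7 : 7 < p)
    (H : Subgroup (PSL 2 (ZMod p))) (hH : IsSolvable ↥H) :
    ∃ K : Subgroup (PSL 2 (ZMod p)), H ≤ K ∧
      ((∃ φ : Multiplicative (ZMod ((p - 1) / 2)) →* MulAut (Multiplicative (ZMod p)),
          Nonempty (↥K ≃* SemidirectProduct (Multiplicative (ZMod p))
            (Multiplicative (ZMod ((p - 1) / 2))) φ)) ∨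
       Nonempty (↥K ≃* alternatingGroup (Fin 4)) ∨
       Nonempty (↥K ≃* Equiv.Perm (Fin 4)) ∨
       Nonempty (↥K ≃* DihedralGroup ((p - 1) / 2)) ∨
       Nonempty (↥K ≃* DihedralGroup ((p + 1) / 2))) := by
  haveI : Fact p.Prime := ⟨hp⟩
  exact main_good (by omega) H hH
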